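/- arXiv:1611.04853 — 14 statements merged into one kernel-verified Lean document; each statement's English description precedes it below -/
import Mathlib

section
/- Let K be a positive integer and let h_1, ..., h_K be real channel gains with 0 < h_1 ≤ h_2 ≤ ... ≤ h_K. Then the two regions C_BC* and C_BC are equal: a vector r ∈ ℝ^K with r_i ≥ 0 for all i satisfies Σ_{i=1}^{K-1} (1/h_i^2 − 1/h_{i+1}^2)·2^{r_1+...+r_i} + (1/h_K^2)·2^{r_1+...+r_K} − 1/h_1^2 ≤ 1 if and only if there exist real numbers α_1, ..., α_K with α_i ≥ 0 for all i and Σ_{i=1}^K α_i = 1 such that r_i ≤ log₂(1 + α_i·h_i^2 / (1 + (Σ_{j>i} α_j)·h_i^2)) for every i ∈ {1,...,K}. -/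
open Finset Real

/-- A rate constraint of the broadcast channel, cleared of its logarithm and its quotient. -/
lemma le_logb_rate_iff {h r a S : ℝ} (hh : 0 < h) (ha : 0 ≤ a) (hS : 0 ≤ S) :
    r ≤ Real.logb 2 (1 + a * h ^ 2 / (1 + S * h ^ 2)) ↔
      (2 : ℝ) ^ r * (1 / h ^ 2 + S) ≤ 1 / h ^ 2 + (a + S) := by
  have h2 : 0 < h ^ 2 := by positivity
  have hden : 0 < 1 / h ^ 2 + S := by positivity
  have hden' : 0 < 1 + S * h ^ 2 := by positivity
  have key : 1 + a * h ^ 2 / (1 + S * h ^ 2) = (1 / h ^ 2 + (a + S)) / (1 / h ^ 2 + S) := by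
    have : 1 / h ^ 2 + S = (1 + S * h ^ 2) / h ^ 2 := by field_simp
    rw [this]
    field_simp
    ring
  rw [Real.le_logb_iff_rpow_le one_lt_two (by positivity), key, le_div_iff₀ hden]

/-- Abel summation on `Icc 1 (m + 1)`. -/
lemma sum_Icc_sub_mul_add (n P : ℕ → ℝ) (m : ℕ) :
    ∑ i ∈ Finset.Icc 1 m, (n i - n (i + 1)) * P i + n (m + 1) * P (m + 1) - n 1 * P 0 =
      ∑ i ∈ Finset.Icc 1 (m + 1), n i * (P i - P (i - 1)) := by
  induction m with
  | zero => simp; ring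
  | succ m ih =>
    rw [Finset.sum_Icc_succ_top (by omega), Finset.sum_Icc_succ_top (by omega : 1 ≤ m + 1 + 1),
      ← ih, Nat.add_sub_cancel]
    ring

lemma sum_Icc_eq_add_sum_Icc_succ (f : ℕ → ℝ) {i K : ℕ} (hi : i ≤ K) :
    ∑ j ∈ Finset.Icc i K, f j = f i + ∑ j ∈ Finset.Icc (i + 1) K, f j := by
  rw [← Finset.insert_Icc_add_one_left_eq_Icc hi, Finset.sum_insert (by simp)]

lemma sum_Icc_sub_succ (f : ℕ → ℝ) {i K : ℕ} (hi : i ≤ K + 1) :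
    ∑ j ∈ Finset.Icc i K, (f j - f (j + 1)) = f i - f (K + 1) := by
  induction hi using Nat.decreasingInduction with
  | self => simp
  | of_succ k hk ih => rw [sum_Icc_eq_add_sum_Icc_succ _ (by omega), ih]; ring

/-- Lemma 1 of the paper: for channel gains `0 < h 1 ≤ h 2 ≤ ⋯ ≤ h K`, a nonnegative
rate vector `r` satisfies the explicit inequality defining `C_BC` iff there exists a
power allocation `α` realizing `r` in the Gaussian broadcast capacity region `C_BC*`. -/
theorem cbc_eq_cbc_star
    (K : ℕ) (hK : 1 ≤ K) (h : ℕ → ℝ)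
    (hpos : ∀ i ∈ Finset.Icc 1 K, 0 < h i)
    (hmono : ∀ i ∈ Finset.Icc 1 (K - 1), h i ≤ h (i + 1))
    (r : ℕ → ℝ) (hr : ∀ i ∈ Finset.Icc 1 K, 0 ≤ r i) :
    (∑ i ∈ Finset.Icc 1 (K - 1),
        (1 / (h i) ^ 2 - 1 / (h (i + 1)) ^ 2) *
          (2 : ℝ) ^ (∑ j ∈ Finset.Icc 1 i, r j)
      + (1 / (h K) ^ 2) * (2 : ℝ) ^ (∑ j ∈ Finset.Icc 1 K, r j)
      - 1 / (h 1) ^ 2 ≤ 1)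
    ↔
    (∃ α : ℕ → ℝ, (∀ i ∈ Finset.Icc 1 K, 0 ≤ α i) ∧
      (∑ i ∈ Finset.Icc 1 K, α i = 1) ∧
      ∀ i ∈ Finset.Icc 1 K,
        r i ≤ Real.logb 2
          (1 + α i * (h i) ^ 2 /
            (1 + (∑ j ∈ Finset.Icc (i + 1) K, α j) * (h i) ^ 2))) := by
  set n : ℕ → ℝ := fun i => 1 / (h i) ^ 2 with hn
  set P : ℕ → ℝ := fun i => (2 : ℝ) ^ (∑ j ∈ Finset.Icc 1 i, r j) with hP
  have hP0 : P 0 = 1 := by simp [hP]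
  have hPpos : ∀ i, 0 < P i := fun i => by positivity
  have hPsucc : ∀ i ∈ Finset.Icc 1 K, P i = P (i - 1) * (2 : ℝ) ^ r i := by
    intro i hi
    obtain ⟨k, rfl⟩ := Nat.exists_eq_add_of_le' (Finset.mem_Icc.1 hi).1
    simp only [hP, Nat.add_sub_cancel]
    rw [Finset.sum_Icc_succ_top (by omega), Real.rpow_add two_pos]
  have hn0 : ∀ i, 0 ≤ n i := fun i => by positivity
  have hone : ∀ i ∈ Finset.Icc 1 K, 1 ≤ (2 : ℝ) ^ r i := fun i hi =>
    Real.one_le_rpow one_le_two (hr i hi)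
  have habel : ∑ i ∈ Finset.Icc 1 (K - 1), (n i - n (i + 1)) * P i + n K * P K - n 1 =
      ∑ i ∈ Finset.Icc 1 K, n i * (P i - P (i - 1)) := by
    have := sum_Icc_sub_mul_add n P (K - 1)
    rwa [Nat.sub_add_cancel hK, hP0, mul_one] at this
  change ∑ i ∈ Finset.Icc 1 (K - 1), (n i - n (i + 1)) * P i + n K * P K - n 1 ≤ 1 ↔ _
  rw [habel]
  constructor
  · intro hle
    set D : ℕ → ℝ := fun i => ∑ j ∈ Finset.Icc i K, n j * (P j - P (j - 1)) with hD
    -- `U i` is the total power given to the users `i, …, K`.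
    set U : ℕ → ℝ := fun i => if i = 1 then 1 else D i / P (i - 1) with hU
    have hD0 : ∀ i, 1 ≤ i → 0 ≤ D i := by
      intro i hi
      refine Finset.sum_nonneg fun j hj => mul_nonneg (hn0 j) ?_
      have hj' : j ∈ Finset.Icc 1 K := by simp only [Finset.mem_Icc] at hj ⊢; omega
      rw [hPsucc j hj']
      nlinarith [hone j hj', hPpos (j - 1)]
    have hUnonneg : ∀ i, 1 ≤ i → 0 ≤ U i := by
      intro i hi
      simp only [hU]
      split_ifs
      · exact zero_le_one
      · exact div_nonneg (hD0 i hi) (hPpos _).le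
    have hUD : ∀ i, 1 ≤ i → D i / P (i - 1) ≤ U i := by
      intro i hi
      simp only [hU]
      split_ifs with h1
      · subst h1
        simpa [hP0] using hle
      · exact le_rfl
    have hUlast : U (K + 1) = 0 := by
      have : K ≠ 0 := by omega
      simp [hU, hD, this]
    have hrec : ∀ i ∈ Finset.Icc 1 K, (2 : ℝ) ^ r i * (n i + U (i + 1)) ≤ n i + U i := by
      intro i hi
      have hi' := Finset.mem_Icc.1 hi
      have hUs : U (i + 1) = D (i + 1) / P i := by
        have : i ≠ 0 := by omega
        simp [hU, this]
      have hDi : D i = n i * (P i - P (i - 1)) + D (i + 1) :=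
        sum_Icc_eq_add_sum_Icc_succ _ hi'.2
      have hUi := hUD i hi'.1
      have hp := hPpos (i - 1)
      have h2 : 0 < (2 : ℝ) ^ r i := by positivity
      rw [hDi] at hUi
      rw [hUs]
      rw [hPsucc i hi] at hUi ⊢
      have : (2 : ℝ) ^ r i * (n i + D (i + 1) / (P (i - 1) * (2 : ℝ) ^ r i)) =
          n i + (n i * (P (i - 1) * (2 : ℝ) ^ r i - P (i - 1)) + D (i + 1)) / P (i - 1) := by
        field_simp
        ring
      linarith
    have hsum : ∀ i, i ≤ K + 1 → ∑ j ∈ Finset.Icc i K, (U j - U (j + 1)) = U i := fun i hi => by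
      rw [sum_Icc_sub_succ U hi, hUlast, sub_zero]
    have hα : ∀ i ∈ Finset.Icc 1 K, 0 ≤ U i - U (i + 1) := by
      intro i hi
      nlinarith [hrec i hi, hone i hi, hn0 i, hUnonneg (i + 1) (by omega)]
    refine ⟨fun i => U i - U (i + 1), hα, ?_, ?_⟩
    · rw [hsum 1 (by omega)]
      simp [hU]
    · intro i hi
      have hi' := Finset.mem_Icc.1 hi
      rw [hsum (i + 1) (by omega),
        le_logb_rate_iff (hpos i hi) (hα i hi) (hUnonneg _ (by omega)), sub_add_cancel]
      exact hrec i hi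
  · rintro ⟨α, hα, hsum, hrate⟩
    set S : ℕ → ℝ := fun i => ∑ j ∈ Finset.Icc i K, α j with hS
    have htel := sum_Icc_sub_succ (fun i => P (i - 1) * S i) (by omega : 1 ≤ K + 1)
    have hS1 : S 1 = 1 := hsum
    have hSlast : S (K + 1) = 0 := by simp [hS]
    simp only [Nat.sub_self, hP0, hS1, hSlast, mul_zero, sub_zero, mul_one,
      Nat.add_sub_cancel] at htel
    rw [← htel]
    refine Finset.sum_le_sum fun i hi => ?_
    have hi' := Finset.mem_Icc.1 hi
    have hS0 : 0 ≤ S (i + 1) := Finset.sum_nonneg fun j hj => hα j (by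
      simp only [Finset.mem_Icc] at hj ⊢; omega)
    have hrec : (2 : ℝ) ^ r i * (n i + S (i + 1)) ≤ n i + S i := by
      rw [show S i = α i + S (i + 1) from sum_Icc_eq_add_sum_Icc_succ α hi'.2]
      exact (le_logb_rate_iff (hpos i hi) (hα i hi) hS0).1 (hrate i hi)
    rw [hPsucc i hi]
    linarith [mul_le_mul_of_nonneg_left hrec (hPpos (i - 1)).le]
end

section
/- Let K be a positive integer, let 0 < h_1 ≤ h_2 ≤ ... ≤ h_K be real channel gains, and let W, P, N_0 > 0 be reals. Suppose α_1, ..., α_K are nonnegative reals and r_1, ..., r_K are nonnegative reals such that r_i ≤ W·log₂(1 + α_i·h_i^2·P / (N_0·W + (Σ_{j>i} α_j)·h_i^2·P)) for every i ∈ {1,...,K}. Then for every m ∈ {1,...,K}: (Σ_{i=K-m+1}^{K} α_i)·P/(N_0·W) ≥ Σ_{i=K-m+1}^{K} (1/h_i^2 − 1/h_{i+1}^2)·2^{(r_{K-m+1}+...+r_i)/W} − 1/h_{K-m+1}^2, where by convention 1/h_{K+1}^2 = 0. -/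
open Finset Real

/-- Splitting the first summand off a weighted sum of exponentials of partial sums. -/
lemma sum_mul_two_rpow_partial_sum_succ (c r : ℕ → ℝ) (W : ℝ) {k K : ℕ} (hk : k ≤ K) :
    ∑ i ∈ Finset.Icc k K, c i * (2 : ℝ) ^ ((∑ j ∈ Finset.Icc k i, r j) / W) =
      (2 : ℝ) ^ (r k / W) * (c k +
        ∑ i ∈ Finset.Icc (k + 1) K,
          c i * (2 : ℝ) ^ ((∑ j ∈ Finset.Icc (k + 1) i, r j) / W)) := by
  rw [← Finset.add_sum_Ioc_eq_sum_Icc hk, ← Finset.Icc_add_one_left_eq_Ioc, Finset.Icc_self,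
    Finset.sum_singleton, mul_add, Finset.mul_sum, mul_comm (c k)]
  congr 1
  refine Finset.sum_congr rfl fun i hi => ?_
  have hki : k ≤ i := by have := (Finset.mem_Icc.mp hi).1; omega
  rw [← Finset.add_sum_Ioc_eq_sum_Icc hki, ← Finset.Icc_add_one_left_eq_Ioc, add_div,
    Real.rpow_add two_pos]
  ring

/-- A rate bound for a Gaussian channel with gain `g`, signal share `a` and interference share `S`,
in exponential form. -/
lemma two_rpow_mul_le_of_rate_le {W P N0 g a S ρ : ℝ} (hW : 0 < W) (hP : 0 < P) (hN0 : 0 < N0)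
    (hg : 0 < g) (ha : 0 ≤ a) (hS : 0 ≤ S)
    (hρ : ρ ≤ W * Real.logb 2 (1 + a * g ^ 2 * P / (N0 * W + S * g ^ 2 * P))) :
    (2 : ℝ) ^ (ρ / W) * (S * P / (N0 * W) + 1 / g ^ 2) ≤
      (a + S) * P / (N0 * W) + 1 / g ^ 2 := by
  have hD : 0 < N0 * W + S * g ^ 2 * P := by positivity
  have hx : 0 < 1 + a * g ^ 2 * P / (N0 * W + S * g ^ 2 * P) := by positivity
  have hpow : (2 : ℝ) ^ (ρ / W) ≤ 1 + a * g ^ 2 * P / (N0 * W + S * g ^ 2 * P) := by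
    rw [← Real.le_logb_iff_rpow_le one_lt_two hx, div_le_iff₀' hW]
    exact hρ
  calc (2 : ℝ) ^ (ρ / W) * (S * P / (N0 * W) + 1 / g ^ 2)
      ≤ (1 + a * g ^ 2 * P / (N0 * W + S * g ^ 2 * P)) * (S * P / (N0 * W) + 1 / g ^ 2) := by
        gcongr
    _ = (a + S) * P / (N0 * W) + 1 / g ^ 2 := by
        have hsum : S * P / (N0 * W) + 1 / g ^ 2 =
            (N0 * W + S * g ^ 2 * P) / (N0 * W * g ^ 2) := by
          field_simp
          ring
        have hcancel : a * g ^ 2 * P / (N0 * W + S * g ^ 2 * P) *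
            ((N0 * W + S * g ^ 2 * P) / (N0 * W * g ^ 2)) = a * P / (N0 * W) := by
          rw [div_mul_div_cancel₀ hD.ne']
          field_simp
        rw [add_mul, one_mul, hsum, hcancel, ← hsum]
        ring

/-- The key inductive inequality (equation (pro1)) of Appendix A: if the rates `r`
are achievable under the power allocation `α` (i.e. `r ∈ C_BC*` with bandwidth `W`,
power `P` and noise density `N₀`), then for every `m ∈ {1,…,K}` the tail inequality
holds, with the convention `1/h_{K+1}² = 0`. -/
theorem cbc_star_subset_cbc_inductive
    (K : ℕ) (hK : 1 ≤ K) (h : ℕ → ℝ)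
    (hpos : ∀ i ∈ Finset.Icc 1 K, 0 < h i)
    (hmono : ∀ i ∈ Finset.Icc 1 (K - 1), h i ≤ h (i + 1))
    (W P N0 : ℝ) (hW : 0 < W) (hP : 0 < P) (hN0 : 0 < N0)
    (α : ℕ → ℝ) (hα : ∀ i ∈ Finset.Icc 1 K, 0 ≤ α i)
    (r : ℕ → ℝ) (hr : ∀ i ∈ Finset.Icc 1 K, 0 ≤ r i)
    (hrate : ∀ i ∈ Finset.Icc 1 K,
      r i ≤ W * Real.logb 2
        (1 + α i * (h i) ^ 2 * P /
          (N0 * W + (∑ j ∈ Finset.Icc (i + 1) K, α j) * (h i) ^ 2 * P))) :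
    ∀ m ∈ Finset.Icc 1 K,
      (∑ i ∈ Finset.Icc (K - m + 1) K, α i) * P / (N0 * W) ≥
        ∑ i ∈ Finset.Icc (K - m + 1) K,
          (1 / (h i) ^ 2 - (if i < K then 1 / (h (i + 1)) ^ 2 else 0)) *
            (2 : ℝ) ^ ((∑ j ∈ Finset.Icc (K - m + 1) i, r j) / W)
        - 1 / (h (K - m + 1)) ^ 2 := by
  have key : ∀ m ≤ K,
      ∑ i ∈ Finset.Icc (K - m + 1) K,
          (1 / (h i) ^ 2 - (if i < K then 1 / (h (i + 1)) ^ 2 else 0)) *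
            (2 : ℝ) ^ ((∑ j ∈ Finset.Icc (K - m + 1) i, r j) / W) ≤
        (∑ i ∈ Finset.Icc (K - m + 1) K, α i) * P / (N0 * W) +
          (if K - m < K then 1 / (h (K - m + 1)) ^ 2 else 0) := by
    intro m
    induction m with
    | zero => simp
    | succ m ih =>
      intro hm
      have IH := ih (by omega)
      obtain ⟨k, hk⟩ : ∃ k, K - (m + 1) + 1 = k := ⟨_, rfl⟩
      have hkm : K - m = k := by omega
      have hkK : k ≤ K := by omega
      have hmem : k ∈ Finset.Icc 1 K := Finset.mem_Icc.mpr ⟨by omega, hkK⟩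
      have hS : 0 ≤ ∑ j ∈ Finset.Icc (k + 1) K, α j :=
        Finset.sum_nonneg fun j hj => hα j (by rw [Finset.mem_Icc] at hj ⊢; omega)
      rw [hkm] at IH
      rw [if_pos (by omega), hk,
        sum_mul_two_rpow_partial_sum_succ
          (fun i => 1 / (h i) ^ 2 - (if i < K then 1 / (h (i + 1)) ^ 2 else 0)) r W hkK,
        ← Finset.add_sum_Ioc_eq_sum_Icc hkK, ← Finset.Icc_add_one_left_eq_Ioc]
      refine le_trans (mul_le_mul_of_nonneg_left ?_ (by positivity))
        (two_rpow_mul_le_of_rate_le hW hP hN0 (hpos k hmem) (hα k hmem) hS (hrate k hmem))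
      linarith
  intro m hm
  obtain ⟨hm1, hmK⟩ := Finset.mem_Icc.mp hm
  have hkey := key m hmK
  rw [if_pos (by omega)] at hkey
  linarith
end

section
/- Let K be a positive integer, let 0 < h_1 ≤ h_2 ≤ ... ≤ h_K be real channel gains, and let W, P, N_0 > 0 be reals. Suppose r_1, ..., r_K are nonnegative reals satisfying Σ_{i=1}^{K} (1/h_i^2 − 1/h_{i+1}^2)·2^{(r_1+...+r_i)/W} − 1/h_1^2 ≤ P/(N_0·W), where by convention 1/h_{K+1}^2 = 0. Then there exist reals α_1, ..., α_K with α_i ≥ 0 for all i and Σ_{i=1}^K α_i = 1 such that r_i ≤ W·log₂(1 + α_i·P·h_i^2/(N_0·W + (Σ_{j>i} α_j)·P·h_i^2)) for every i ∈ {1,...,K}. -/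
open Finset Real

/-- Abel-type tail sums dominate their leading term when the weights increase. -/
lemma mul_le_sum_Icc_sub_mul {K : ℕ} {g E : ℕ → ℝ} (hg : ∀ i ∈ Finset.Icc 1 K, 0 < g i)
    (hgK : g (K + 1) = 0) (hE : ∀ i ∈ Finset.Icc 1 K, E (i - 1) ≤ E i)
    {m : ℕ} (hm : m ≤ K + 1) (hm1 : 1 ≤ m) :
    g m * E (m - 1) ≤ ∑ j ∈ Finset.Icc m K, (g j - g (j + 1)) * E j := by
  induction hm using Nat.decreasingInduction with
  | self => simp [hgK]
  | of_succ i hi ih =>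
    have him : i ∈ Finset.Icc 1 K := Finset.mem_Icc.2 ⟨hm1, by omega⟩
    have hih := ih (by omega)
    rw [Nat.add_sub_cancel] at hih
    rw [← Finset.add_sum_Ioc_eq_sum_Icc (by omega : i ≤ K), ← Finset.Icc_add_one_left_eq_Ioc]
    have hmul := mul_le_mul_of_nonneg_left (hE i him) (hg i him).le
    linarith

/-- Normalized power allocation: with noise levels `g` and cumulative gains `E`, a power budget
`q` above the explicit threshold can be split so that each step realizes the gain
`E i / E (i - 1)` against the noise and the interference of the later users. -/
lemma exists_power_split {K : ℕ} (hK : 1 ≤ K) {g E : ℕ → ℝ}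
    (hg : ∀ i ∈ Finset.Icc 1 K, 0 < g i) (hgK : g (K + 1) = 0)
    (hE : ∀ i ∈ Finset.Icc 1 K, E (i - 1) ≤ E i) (hEpos : ∀ i, 0 < E i) (hE0 : E 0 = 1) {q : ℝ}
    (hq : ∑ i ∈ Finset.Icc 1 K, (g i - g (i + 1)) * E i - g 1 ≤ q) :
    ∃ β : ℕ → ℝ, (∀ i ∈ Finset.Icc 1 K, 0 ≤ β i) ∧ ∑ i ∈ Finset.Icc 1 K, β i = q ∧
      ∀ i ∈ Finset.Icc 1 K,
        E i * (g i + ∑ j ∈ Finset.Icc (i + 1) K, β j) ≤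
          E (i - 1) * (g i + β i + ∑ j ∈ Finset.Icc (i + 1) K, β j) := by
  let S : ℕ → ℝ := fun m => ∑ j ∈ Finset.Icc m K, (g j - g (j + 1)) * E j
  let D : ℕ → ℝ := fun m => S m / E (m - 1) - g m
  let β : ℕ → ℝ := fun i => if i = 1 then q - D 2 else D i - D (i + 1)
  have hS : ∀ i ∈ Finset.Icc 1 K, S i = (g i - g (i + 1)) * E i + S (i + 1) := by
    intro i hi
    change ∑ j ∈ Finset.Icc i K, (g j - g (j + 1)) * E j = _
    rw [← Finset.add_sum_Ioc_eq_sum_Icc (Finset.mem_Icc.1 hi).2,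
      ← Finset.Icc_add_one_left_eq_Ioc]
  have hS0 : ∀ i ∈ Finset.Icc 1 K, 0 ≤ S i := fun i hi =>
    (mul_nonneg (hg i hi).le (hEpos _).le).trans
      (mul_le_sum_Icc_sub_mul hg hgK hE (by have := (Finset.mem_Icc.1 hi).2; omega)
        (Finset.mem_Icc.1 hi).1)
  have hDK : D (K + 1) = 0 := by simp [D, S, hgK]
  have hD1 : D 1 ≤ q := by simpa [D, S, hE0] using hq
  have hDsucc : ∀ i ∈ Finset.Icc 1 K, g i + D (i + 1) = S i / E i := by
    intro i hi
    have := (hEpos i).ne'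
    simp only [D, Nat.add_sub_cancel, hS i hi]
    field_simp
    ring
  have hDle : ∀ i ∈ Finset.Icc 1 K, D (i + 1) ≤ D i := by
    intro i hi
    have h1 := hDsucc i hi
    have h2 : S i / E i ≤ S i / E (i - 1) :=
      div_le_div_of_nonneg_left (hS0 i hi) (hEpos _) (hE i hi)
    have h3 : D i = S i / E (i - 1) - g i := rfl
    linarith
  have hβ : ∀ i ∈ Finset.Icc 1 K, D i - D (i + 1) ≤ β i := by
    intro i _
    by_cases h1 : i = 1
    · subst h1
      simpa [β] using hD1
    · simp [β, h1]
  have htail : ∀ m, 1 ≤ m → m ≤ K → ∑ j ∈ Finset.Icc (m + 1) K, β j = D (m + 1) := by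
    intro m hm hmK
    have hcongr : ∀ j ∈ Finset.Ico (m + 1) (K + 1), β j = D j - D (j + 1) := by
      intro j hj
      have : j ≠ 1 := by have := Finset.mem_Ico.1 hj; omega
      simp [β, this]
    have htel := Finset.sum_Ico_sub D (by omega : m + 1 ≤ K + 1)
    rw [Finset.sum_sub_distrib] at htel
    rw [← Finset.Ico_add_one_right_eq_Icc, Finset.sum_congr rfl hcongr, Finset.sum_sub_distrib]
    linarith
  refine ⟨β, fun i hi => ?_, ?_, fun i hi => ?_⟩
  · linarith [hβ i hi, hDle i hi]
  · rw [← Finset.add_sum_Ioc_eq_sum_Icc hK, ← Finset.Icc_add_one_left_eq_Ioc, htail 1 le_rfl hK]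
    simp [β]
  · rw [htail i (Finset.mem_Icc.1 hi).1 (Finset.mem_Icc.1 hi).2, hDsucc i hi,
      mul_div_cancel₀ _ (hEpos i).ne']
    have h1 : S i = E (i - 1) * (g i + D i) := by
      have := (hEpos (i - 1)).ne'
      simp only [D]
      field_simp
      ring
    rw [h1]
    exact mul_le_mul_of_nonneg_left (by linarith [hβ i hi]) (hEpos _).le

/-- The reverse inclusion `C_BC ⊆ C_BC*` of Appendix A, subsection B: every
nonnegative rate vector satisfying the explicit inequality (with the convention
`1/h_{K+1}² = 0`) is achievable by some power allocation `α`. -/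
theorem cbc_subset_cbc_star
    (K : ℕ) (hK : 1 ≤ K) (h : ℕ → ℝ)
    (hpos : ∀ i ∈ Finset.Icc 1 K, 0 < h i)
    (hmono : ∀ i ∈ Finset.Icc 1 (K - 1), h i ≤ h (i + 1))
    (W P N0 : ℝ) (hW : 0 < W) (hP : 0 < P) (hN0 : 0 < N0)
    (r : ℕ → ℝ) (hr : ∀ i ∈ Finset.Icc 1 K, 0 ≤ r i)
    (hcap : ∑ i ∈ Finset.Icc 1 K,
        (1 / (h i) ^ 2 - (if i < K then 1 / (h (i + 1)) ^ 2 else 0)) *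
          (2 : ℝ) ^ ((∑ j ∈ Finset.Icc 1 i, r j) / W)
      - 1 / (h 1) ^ 2 ≤ P / (N0 * W)) :
    ∃ α : ℕ → ℝ, (∀ i ∈ Finset.Icc 1 K, 0 ≤ α i) ∧
      (∑ i ∈ Finset.Icc 1 K, α i = 1) ∧
      ∀ i ∈ Finset.Icc 1 K,
        r i ≤ W * Real.logb 2
          (1 + α i * P * (h i) ^ 2 /
            (N0 * W + (∑ j ∈ Finset.Icc (i + 1) K, α j) * P * (h i) ^ 2)) := by
  let g : ℕ → ℝ := fun i => if i ≤ K then 1 / (h i) ^ 2 else 0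
  let E : ℕ → ℝ := fun i => (2 : ℝ) ^ ((∑ j ∈ Finset.Icc 1 i, r j) / W)
  have hgi : ∀ i ∈ Finset.Icc 1 K, g i = 1 / (h i) ^ 2 := fun i hi =>
    if_pos (Finset.mem_Icc.1 hi).2
  have hg : ∀ i ∈ Finset.Icc 1 K, 0 < g i := by
    intro i hi
    have := hpos i hi
    rw [hgi i hi]
    positivity
  have hEpos : ∀ i, 0 < E i := fun i => by positivity
  have hEstep : ∀ i ∈ Finset.Icc 1 K, E i = E (i - 1) * (2 : ℝ) ^ (r i / W) := by
    intro i hi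
    obtain ⟨k, rfl⟩ := Nat.exists_eq_add_of_le' (Finset.mem_Icc.1 hi).1
    simp only [E, Nat.add_sub_cancel]
    rw [← Real.rpow_add two_pos, Finset.sum_Icc_succ_top (by omega), add_div]
  have hE : ∀ i ∈ Finset.Icc 1 K, E (i - 1) ≤ E i := by
    intro i hi
    rw [hEstep i hi]
    exact le_mul_of_one_le_right (hEpos _).le
      (Real.one_le_rpow one_le_two (div_nonneg (hr i hi) hW.le))
  have hq : ∑ i ∈ Finset.Icc 1 K, (g i - g (i + 1)) * E i - g 1 ≤ P / (N0 * W) := by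
    rw [hgi 1 (Finset.mem_Icc.2 ⟨le_rfl, hK⟩)]
    refine le_trans (le_of_eq ?_) hcap
    congr 1
    exact Finset.sum_congr rfl fun i hi => by
      rw [hgi i hi]
      simp only [g, E, Nat.add_one_le_iff]
  obtain ⟨β, hβ, hsum, hrate⟩ :=
    exists_power_split hK hg (by simp [g]) hE hEpos (by simp [E]) hq
  refine ⟨fun i => N0 * W / P * β i, fun i hi => mul_nonneg (by positivity) (hβ i hi), ?_,
    fun i hi => ?_⟩
  · rw [← Finset.mul_sum, hsum]
    field_simp
  · have hT : 0 ≤ ∑ j ∈ Finset.Icc (i + 1) K, β j := Finset.sum_nonneg fun j hj =>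
      hβ j (Finset.Icc_subset_Icc_left (by omega) hj)
    have hi' := hrate i hi
    rw [← Finset.mul_sum]
    generalize ∑ j ∈ Finset.Icc (i + 1) K, β j = T at hT hi' ⊢
    have hh := hpos i hi
    have hb := hβ i hi
    have hgp := hg i hi
    rw [hEstep i hi, mul_assoc, mul_le_mul_iff_right₀ (hEpos _)] at hi'
    have hsnr : 1 + N0 * W / P * β i * P * h i ^ 2 / (N0 * W + N0 * W / P * T * P * h i ^ 2) =
        (g i + β i + T) / (g i + T) := by
      rw [hgi i hi]
      field_simp
      ring
    rw [hsnr, ← div_le_iff₀' hW, Real.le_logb_iff_rpow_le one_lt_two (by positivity),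
      le_div_iff₀ (by positivity)]
    exact hi'
end

section
/- Let K, t be integers with 1 ≤ t < K and let 0 < h_1 ≤ h_2 ≤ ... ≤ h_{K−t} be real channel gains. Define g_c : (0,∞) → ℝ by g_c(s) = Σ_{i=1}^{K−t−1} (1/h_i^2 − 1/h_{i+1}^2)·2^{(C(K,t+1) − C(K−i,t+1))/(C(K,t)·s)} + (1/h_{K−t}^2)·2^{C(K,t+1)/(C(K,t)·s)} − 1/h_1^2 − 1, where C(n,k) denotes the binomial coefficient. Then g_c is strictly decreasing on (0,∞), g_c(s) → +∞ as s → 0⁺, g_c(s) → −1 as s → +∞, and consequently g_c has a unique root in (0,∞). -/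
open Finset Real Filter

lemma antitoneOn_two_rpow_div_mul {a m : ℝ} (ha : 0 ≤ a) (hm : 0 < m) :
    AntitoneOn (fun s : ℝ => (2 : ℝ) ^ (a / (m * s))) (Set.Ioi 0) := by
  intro x hx y _ hxy
  have hx' : 0 < x := hx
  refine Real.rpow_le_rpow_of_exponent_le one_le_two ?_
  exact div_le_div_of_nonneg_left ha (by positivity) (by gcongr)

lemma strictAntiOn_two_rpow_div_mul {a m : ℝ} (ha : 0 < a) (hm : 0 < m) :
    StrictAntiOn (fun s : ℝ => (2 : ℝ) ^ (a / (m * s))) (Set.Ioi 0) := by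
  intro x hx y _ hxy
  have hx' : 0 < x := hx
  refine Real.rpow_lt_rpow_of_exponent_lt one_lt_two ?_
  exact div_lt_div_of_pos_left ha (by positivity) (by gcongr)

lemma continuousOn_two_rpow_div_mul (a : ℝ) {m : ℝ} (hm : 0 < m) :
    ContinuousOn (fun s : ℝ => (2 : ℝ) ^ (a / (m * s))) (Set.Ioi 0) := by
  refine ContinuousOn.rpow continuousOn_const ?_ (fun _ _ => Or.inl two_ne_zero)
  refine continuousOn_const.div (by fun_prop) ?_
  intro x hx
  exact (mul_pos hm hx).ne'

lemma tendsto_two_rpow_div_mul_atTop (a : ℝ) {m : ℝ} (hm : 0 < m) :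
    Tendsto (fun s : ℝ => (2 : ℝ) ^ (a / (m * s))) atTop (nhds 1) := by
  have h0 : Tendsto (fun s : ℝ => a / (m * s)) atTop (nhds 0) :=
    tendsto_const_nhds.div_atTop (tendsto_id.const_mul_atTop hm)
  simpa using (tendsto_const_nhds (x := (2 : ℝ))).rpow h0 (Or.inl two_ne_zero)

lemma tendsto_two_rpow_div_mul_nhdsGT_zero {a m : ℝ} (ha : 0 < a) (hm : 0 < m) :
    Tendsto (fun s : ℝ => (2 : ℝ) ^ (a / (m * s))) (nhdsWithin 0 (Set.Ioi 0)) atTop := by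
  have h0 : Tendsto (fun s : ℝ => a / (m * s)) (nhdsWithin 0 (Set.Ioi 0)) atTop := by
    have := tendsto_inv_nhdsGT_zero (𝕜 := ℝ) |>.const_mul_atTop (div_pos ha hm)
    refine this.congr fun s => ?_
    rw [div_mul_eq_div_div, div_eq_mul_inv (a / m)]
  exact (tendsto_rpow_atTop_of_base_gt_one 2 one_lt_two).comp h0

/-- A strictly decreasing continuous function on `(0, ∞)` that tends to `+∞` at `0⁺` and to a
negative limit at `+∞` has exactly one positive root. -/
lemma existsUnique_pos_root_of_strictAntiOn {g : ℝ → ℝ} {l : ℝ}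
    (hanti : StrictAntiOn g (Set.Ioi 0)) (hcont : ContinuousOn g (Set.Ioi 0))
    (hzero : Tendsto g (nhdsWithin 0 (Set.Ioi 0)) atTop)
    (htop : Tendsto g atTop (nhds l)) (hl : l < 0) :
    ∃! s : ℝ, 0 < s ∧ g s = 0 := by
  obtain ⟨x, hgx, hx⟩ := ((hzero.eventually_ge_atTop 0).and self_mem_nhdsWithin).exists
  obtain ⟨y, hgy, hy⟩ := ((htop.eventually_lt_const hl).and (eventually_gt_atTop 0)).exists
  obtain ⟨s, hs, hgs⟩ := isPreconnected_Ioi.intermediate_value (Set.mem_Ioi.2 hy) hx hcont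
    ⟨hgy.le, hgx⟩
  refine ⟨s, ⟨hs, hgs⟩, fun r hr => ?_⟩
  exact hanti.injOn hr.1 hs (hr.2.trans hgs.symm)

lemma sum_Icc_one_sub_succ (f : ℕ → ℝ) (n : ℕ) :
    ∑ i ∈ Finset.Icc 1 n, (f i - f (i + 1)) = f 1 - f (n + 1) := by
  induction n with
  | zero => simp
  | succ n ih =>
    rw [Finset.sum_Icc_succ_top (by omega), ih]
    ring

/-- Properties of the function `g_c` whose unique positive root is the transmission
time of the centralized concurrent delivery scheme: `g_c` is strictly decreasing on
`(0,∞)`, tends to `+∞` as `s → 0⁺`, tends to `-1` as `s → +∞`, and has a unique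
positive root. -/
theorem gc_strictAnti_and_unique_root
    (K t : ℕ) (ht : 1 ≤ t) (htK : t < K) (h : ℕ → ℝ)
    (hpos : ∀ i ∈ Finset.Icc 1 (K - t), 0 < h i)
    (hmono : ∀ i ∈ Finset.Icc 1 (K - t - 1), h i ≤ h (i + 1)) :
    let g : ℝ → ℝ := fun s =>
      ∑ i ∈ Finset.Icc 1 (K - t - 1),
        (1 / (h i) ^ 2 - 1 / (h (i + 1)) ^ 2) *
          (2 : ℝ) ^ (((K.choose (t + 1) : ℝ) - ((K - i).choose (t + 1) : ℝ)) /
            ((K.choose t : ℝ) * s))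
      + (1 / (h (K - t)) ^ 2) *
          (2 : ℝ) ^ ((K.choose (t + 1) : ℝ) / ((K.choose t : ℝ) * s))
      - 1 / (h 1) ^ 2 - 1
    StrictAntiOn g (Set.Ioi (0 : ℝ)) ∧
    Tendsto g (nhdsWithin 0 (Set.Ioi (0 : ℝ))) atTop ∧
    Tendsto g atTop (nhds (-1)) ∧
    ∃! s : ℝ, 0 < s ∧ g s = 0 := by
  intro g
  have hm : (0 : ℝ) < K.choose t := by exact_mod_cast Nat.choose_pos htK.le
  have ha : (0 : ℝ) < K.choose (t + 1) := by exact_mod_cast Nat.choose_pos htK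
  have hc : 0 < 1 / (h (K - t)) ^ 2 := by
    have := hpos (K - t) (Finset.mem_Icc.2 ⟨by omega, le_rfl⟩)
    positivity
  have hci : ∀ i ∈ Finset.Icc 1 (K - t - 1), 0 ≤ 1 / (h i) ^ 2 - 1 / (h (i + 1)) ^ 2 := by
    intro i hi
    have hi' := Finset.mem_Icc.1 hi
    have h1 := hpos i (Finset.mem_Icc.2 ⟨hi'.1, by omega⟩)
    have h2 := hmono i hi
    exact sub_nonneg.2 (one_div_le_one_div_of_le (by positivity) (by gcongr))
  have hai : ∀ i : ℕ, (0 : ℝ) ≤ (K.choose (t + 1) : ℝ) - ((K - i).choose (t + 1) : ℝ) := by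
    intro i
    exact sub_nonneg.2 (by exact_mod_cast Nat.choose_le_choose (t + 1) (Nat.sub_le K i))
  have hanti : StrictAntiOn g (Set.Ioi 0) := by
    intro x hx y hy hxy
    refine sub_lt_sub_right (sub_lt_sub_right (add_lt_add_of_le_of_lt ?_ ?_) _) _
    · exact Finset.sum_le_sum fun i hi => mul_le_mul_of_nonneg_left
        (antitoneOn_two_rpow_div_mul (hai i) hm hx hy hxy.le) (hci i hi)
    · exact mul_lt_mul_of_pos_left (strictAntiOn_two_rpow_div_mul ha hm hx hy hxy) hc
  have hcont : ContinuousOn g (Set.Ioi 0) :=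
    (((continuousOn_finsetSum _ fun i _ => continuousOn_const.mul
      (continuousOn_two_rpow_div_mul _ hm)).add (continuousOn_const.mul
      (continuousOn_two_rpow_div_mul _ hm))).sub continuousOn_const).sub continuousOn_const
  have hzero : Tendsto g (nhdsWithin 0 (Set.Ioi 0)) atTop := by
    have hlast := (tendsto_two_rpow_div_mul_nhdsGT_zero ha hm).const_mul_atTop hc
    refine tendsto_atTop_mono (fun s => ?_)
      (tendsto_atTop_add_const_right _ (-(1 / (h 1) ^ 2) - 1) hlast)
    have hsum : 0 ≤ ∑ i ∈ Finset.Icc 1 (K - t - 1), (1 / (h i) ^ 2 - 1 / (h (i + 1)) ^ 2) *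
        (2 : ℝ) ^ (((K.choose (t + 1) : ℝ) - ((K - i).choose (t + 1) : ℝ)) /
          ((K.choose t : ℝ) * s)) :=
      Finset.sum_nonneg fun i hi => mul_nonneg (hci i hi) (by positivity)
    simp only [g]
    linarith
  have htop : Tendsto g atTop (nhds (-1)) := by
    have hlim := (((tendsto_finsetSum (Finset.Icc 1 (K - t - 1)) fun i _ =>
      (tendsto_two_rpow_div_mul_atTop ((K.choose (t + 1) : ℝ) - ((K - i).choose (t + 1) : ℝ))
        hm).const_mul (1 / (h i) ^ 2 - 1 / (h (i + 1)) ^ 2)).add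
      ((tendsto_two_rpow_div_mul_atTop (K.choose (t + 1) : ℝ) hm).const_mul
        (1 / (h (K - t)) ^ 2))).sub_const (1 / (h 1) ^ 2)).sub_const 1
    convert hlim using 2
    simp only [mul_one]
    rw [sum_Icc_one_sub_succ (fun i => 1 / (h i) ^ 2), Nat.sub_add_cancel (by omega)]
    ring
  exact ⟨hanti, hzero, htop,
    existsUnique_pos_root_of_strictAntiOn hanti hcont hzero htop (by norm_num)⟩
end

section
/- Let K, t be integers with 1 ≤ t < K and let 0 < h_1 ≤ h_2 ≤ ... ≤ h_{K−t} be real channel gains. Define T_{c,o} = (1/C(K,t))·Σ_{i=1}^{K−t} C(K−i,t)/log₂(1+h_i^2) and g_c(s) = Σ_{i=1}^{K−t−1} (1/h_i^2 − 1/h_{i+1}^2)·2^{(C(K,t+1) − C(K−i,t+1))/(C(K,t)·s)} + (1/h_{K−t}^2)·2^{C(K,t+1)/(C(K,t)·s)} − 1/h_1^2 − 1, where C(n,k) denotes the binomial coefficient. Then g_c(T_{c,o}) ≤ 0; consequently, every s* > 0 with g_c(s*) = 0 satisfies s* ≤ T_{c,o}. -/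
open Finset Real

/-- Secants of `y ↦ (1 + y) ^ q` issued from `0` have decreasing slopes when `0 ≤ q ≤ 1`. -/
lemma one_add_rpow_sub_one_div_le {x y q : ℝ} (hx : 0 < x) (hxy : x ≤ y) (hq0 : 0 ≤ q)
    (hq1 : q ≤ 1) : 1 / y * ((1 + y) ^ q - 1) ≤ 1 / x * ((1 + x) ^ q - 1) := by
  have hy : 0 < y := hx.trans_le hxy
  have h1 : (1 : ℝ) ∈ Set.Ici (0 : ℝ) := Set.mem_Ici.2 zero_le_one
  have h2 : 1 + y ∈ Set.Ici (0 : ℝ) := Set.mem_Ici.2 (by linarith)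
  have h3 : 0 ≤ 1 - x / y := by
    rw [sub_nonneg, div_le_one hy]
    exact hxy
  have h4 : 0 ≤ x / y := by positivity
  have hc := (Real.concaveOn_rpow hq0 hq1).2 h1 h2 h3 h4 (by ring)
  have he : (1 - x / y) • (1 : ℝ) + (x / y) • (1 + y) = 1 + x := by
    simp only [smul_eq_mul]
    field_simp
    ring
  rw [he] at hc
  simp only [smul_eq_mul, Real.one_rpow] at hc
  have hk : x / y * ((1 + y) ^ q - 1) ≤ (1 + x) ^ q - 1 := by linarith
  calc 1 / y * ((1 + y) ^ q - 1) = 1 / x * (x / y * ((1 + y) ^ q - 1)) := by field_simp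
    _ ≤ 1 / x * ((1 + x) ^ q - 1) := by gcongr

/-- If `U` is the running product of the `(1 + x i) ^ p i`, where the `x i` increase and the
weights `p i` are nonnegative with sum at most `1`, then the Abel-type sums of `U` against the
increments of `1 / x` are bounded by `1 / x 1 + 1`. -/
lemma sum_inv_sub_mul_add_rpow_le (n : ℕ) (x p U : ℕ → ℝ)
    (hx : ∀ i ∈ Finset.Icc 1 n, 0 < x i)
    (hmono : ∀ i ∈ Finset.Icc 1 (n - 1), x i ≤ x (i + 1))
    (hp : ∀ i ∈ Finset.Icc 1 n, 0 ≤ p i) (hsum : ∑ i ∈ Finset.Icc 1 n, p i ≤ 1)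
    (hU0 : U 0 = 1) (hU : ∀ i < n, U (i + 1) = U i * (1 + x (i + 1)) ^ p (i + 1))
    (hUnonneg : ∀ i, 0 ≤ U i) (k : ℕ) (hk : k + 1 ≤ n) :
    ∑ i ∈ Finset.Icc 1 k, (1 / x i - 1 / x (i + 1)) * U i +
      1 / x (k + 1) * (U (k + 1) * (1 + x (k + 1)) ^ (1 - ∑ i ∈ Finset.Icc 1 (k + 1), p i)) ≤
      1 / x 1 + 1 := by
  induction k with
  | zero =>
    have h1 : 0 < x 1 := hx 1 (by simp; omega)
    have hU1 := hU 0 (by omega)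
    simp only [zero_add] at hU1
    simp only [zero_add, Finset.Icc_self, Finset.sum_singleton]
    rw [hU1, hU0, one_mul, ← Real.rpow_add (by linarith), add_sub_cancel, Real.rpow_one]
    simp only [zero_lt_one, Finset.Icc_eq_empty_of_lt, Finset.sum_empty, zero_add]
    apply le_of_eq
    field_simp
  | succ k ih =>
    have ih := ih (by omega)
    have h1 : 0 < x (k + 1) := hx _ (by simp; omega)
    have h2 : 0 < x (k + 1 + 1) := hx _ (by simp; omega)
    have hm : x (k + 1) ≤ x (k + 1 + 1) := hmono _ (by simp; omega)
    have hS : ∑ i ∈ Finset.Icc 1 (k + 1), p i ≤ ∑ i ∈ Finset.Icc 1 n, p i :=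
      Finset.sum_le_sum_of_subset_of_nonneg (Finset.Icc_subset_Icc_right (by omega))
        fun i hi _ => hp i hi
    have hS0 : 0 ≤ ∑ i ∈ Finset.Icc 1 (k + 1), p i :=
      Finset.sum_nonneg fun i hi => hp i (by simp at hi ⊢; omega)
    rw [Finset.sum_Icc_succ_top (by omega : 1 ≤ k + 1),
      Finset.sum_Icc_succ_top (by omega : 1 ≤ k + 1 + 1), hU (k + 1) (by omega), mul_assoc,
      ← Real.rpow_add (by linarith)]
    set q := 1 - ∑ i ∈ Finset.Icc 1 (k + 1), p i with hq
    have he : p (k + 1 + 1) + (1 - (∑ i ∈ Finset.Icc 1 (k + 1), p i + p (k + 1 + 1))) = q := by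
      rw [hq]; ring
    rw [he]
    have := mul_le_mul_of_nonneg_left
      (one_add_rpow_sub_one_div_le (q := q) h1 hm (by linarith) (by linarith))
      (hUnonneg (k + 1))
    linarith

theorem gc_at_Tco_nonpos
    (K t : ℕ) (ht : 1 ≤ t) (htK : t < K) (h : ℕ → ℝ)
    (hpos : ∀ i ∈ Finset.Icc 1 (K - t), 0 < h i)
    (hmono : ∀ i ∈ Finset.Icc 1 (K - t - 1), h i ≤ h (i + 1)) :
    let Tco : ℝ := (1 / (K.choose t : ℝ)) *
      ∑ i ∈ Finset.Icc 1 (K - t),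
        ((K - i).choose t : ℝ) / Real.logb 2 (1 + (h i) ^ 2)
    let g : ℝ → ℝ := fun s =>
      ∑ i ∈ Finset.Icc 1 (K - t - 1),
        (1 / (h i) ^ 2 - 1 / (h (i + 1)) ^ 2) *
          (2 : ℝ) ^ (((K.choose (t + 1) : ℝ) - ((K - i).choose (t + 1) : ℝ)) /
            ((K.choose t : ℝ) * s))
      + (1 / (h (K - t)) ^ 2) *
          (2 : ℝ) ^ ((K.choose (t + 1) : ℝ) / ((K.choose t : ℝ) * s))
      - 1 / (h 1) ^ 2 - 1
    g Tco ≤ 0 ∧ ∀ s : ℝ, 0 < s → g s = 0 → s ≤ Tco := by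
  intro Tco g
  have hC : (0 : ℝ) < K.choose t := by exact_mod_cast Nat.choose_pos htK.le
  have hC' : (0 : ℝ) < K.choose (t + 1) := by exact_mod_cast Nat.choose_pos htK
  have hL : ∀ i ∈ Finset.Icc 1 (K - t), 0 < Real.logb 2 (1 + h i ^ 2) := fun i hi =>
    Real.logb_pos (by norm_num) (by have := hpos i hi; nlinarith)
  have hw : ∀ i ∈ Finset.Icc 1 (K - t),
      0 < ((K - i).choose t : ℝ) / Real.logb 2 (1 + h i ^ 2) := fun i hi =>
    div_pos (by
      rw [Finset.mem_Icc] at hi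
      exact_mod_cast Nat.choose_pos (by omega)) (hL i hi)
  have hS : 0 < ∑ i ∈ Finset.Icc 1 (K - t),
      ((K - i).choose t : ℝ) / Real.logb 2 (1 + h i ^ 2) :=
    Finset.sum_pos hw ⟨1, by simp; omega⟩
  have hTS : (K.choose t : ℝ) * Tco = ∑ i ∈ Finset.Icc 1 (K - t),
      ((K - i).choose t : ℝ) / Real.logb 2 (1 + h i ^ 2) := by
    simp only [Tco]
    field_simp
  have hT : 0 < Tco := by positivity
  have hmain : g Tco ≤ 0 := by
    simp only [g]
    rw [hTS]
    set S := ∑ i ∈ Finset.Icc 1 (K - t), ((K - i).choose t : ℝ) / Real.logb 2 (1 + h i ^ 2)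
    have key := sum_inv_sub_mul_add_rpow_le (K - t) (fun i => h i ^ 2)
      (fun i => ((K - i).choose t : ℝ) / Real.logb 2 (1 + h i ^ 2) / S)
      (fun i => (2 : ℝ) ^ (((K.choose (t + 1) : ℝ) - ((K - i).choose (t + 1) : ℝ)) / S))
      (fun i hi => by have := hpos i hi; positivity)
      (fun i hi => by
        have := hpos i (by simp at hi ⊢; omega)
        have := hmono i hi
        gcongr)
      (fun i hi => (div_pos (hw i hi) hS).le)
      (by rw [← Finset.sum_div]; exact (div_self hS.ne').le)
      (by simp)
      (fun i hi => by
        have hL' := hL (i + 1) (by simp; omega)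
        have hpow : (1 + h (i + 1) ^ 2) = (2 : ℝ) ^ Real.logb 2 (1 + h (i + 1) ^ 2) :=
          (Real.rpow_logb (by norm_num) (by norm_num) (by positivity)).symm
        have hpascal : ((K - i).choose (t + 1) : ℝ) =
            (K - (i + 1)).choose t + (K - (i + 1)).choose (t + 1) := by
          rw [show K - i = K - (i + 1) + 1 by omega, Nat.choose_succ_succ]
          push_cast
          rfl
        have hexp : (1 + h (i + 1) ^ 2) ^
            (((K - (i + 1)).choose t : ℝ) / Real.logb 2 (1 + h (i + 1) ^ 2) / S) =
            (2 : ℝ) ^ (((K - (i + 1)).choose t : ℝ) / S) := by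
          conv_lhs => rw [hpow]
          rw [← Real.rpow_mul (by norm_num), ← hpow]
          congr 1
          field_simp
        rw [hexp, ← Real.rpow_add (by norm_num), hpascal]
        congr 1
        ring)
      (fun i => by positivity) (K - t - 1) (by omega)
    have h1 : K - t - 1 + 1 = K - t := by omega
    have h2 : K - (K - t) = t := by omega
    simp only [h1, h2, Nat.choose_succ_self, Nat.cast_zero, sub_zero] at key
    rw [← Finset.sum_div, div_self hS.ne', sub_self, Real.rpow_zero, mul_one] at key
    linarith
  refine ⟨hmain, fun s hs hgs => ?_⟩
  by_contra! hlt
  have hlast : 0 < h (K - t) := hpos _ (by simp; omega)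
  have hstrict : g s < g Tco := by
    simp only [g]
    refine sub_lt_sub_right (sub_lt_sub_right (add_lt_add_of_le_of_lt ?_ ?_) _) _
    · refine Finset.sum_le_sum fun i hi => ?_
      have hi0 := hpos i (by simp at hi ⊢; omega)
      have him := hmono i hi
      have hch : ((K - i).choose (t + 1) : ℝ) ≤ K.choose (t + 1) := by
        exact_mod_cast Nat.choose_le_choose _ (by omega)
      have hinv : 1 / h (i + 1) ^ 2 ≤ 1 / h i ^ 2 := by gcongr
      refine mul_le_mul_of_nonneg_left ?_ (sub_nonneg.2 hinv)
      refine Real.rpow_le_rpow_of_exponent_le (by norm_num) ?_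
      exact div_le_div_of_nonneg_left (sub_nonneg.2 hch) (by positivity) (by gcongr)
    · refine mul_lt_mul_of_pos_left ?_ (by positivity)
      refine Real.rpow_lt_rpow_of_exponent_lt (by norm_num) ?_
      exact div_lt_div_of_pos_left hC' (by positivity) (by gcongr)
  linarith
end

section
/- Let K, t be integers with 1 ≤ t < K and let 0 < h_1 ≤ h_2 ≤ ... ≤ h_{K−t} be real channel gains. Define T_{c,o} = (1/C(K,t))·Σ_{i=1}^{K−t} C(K−i,t)/log₂(1+h_i^2) and g_c(s) = Σ_{i=1}^{K−t−1} (1/h_i^2 − 1/h_{i+1}^2)·2^{(C(K,t+1) − C(K−i,t+1))/(C(K,t)·s)} + (1/h_{K−t}^2)·2^{C(K,t+1)/(C(K,t)·s)} − 1/h_1^2 − 1, where C(n,k) denotes the binomial coefficient. If h_1 = h_2 = ... = h_{K−t}, then g_c(T_{c,o}) = 0, i.e., the unique positive root of g_c equals T_{c,o}; conversely, if K − t ≥ 2 and the gains are not all equal, then g_c(T_{c,o}) < 0, i.e., the unique positive root of g_c is strictly smaller than T_{c,o}. -/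
open Finset Real

lemma sum_weight_ite_eq {ι : Type*} [DecidableEq ι] {s u : Finset ι} (hus : u ⊆ s)
    {w : ι → ℝ} (hw1 : ∑ j ∈ s, w j = 1) (y : ι → ℝ) :
    ∑ j ∈ s, w j * (if j ∈ u then y j else 1) = 1 + ∑ j ∈ u, w j * (y j - 1) := by
  have hsplit : ∀ j ∈ s, w j * (if j ∈ u then y j else 1)
      = w j + (if j ∈ u then w j * (y j - 1) else 0) := by
    intro j _
    split_ifs <;> ring
  rw [sum_congr rfl hsplit, sum_add_distrib, hw1, sum_ite_mem, inter_eq_right.mpr hus]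

lemma sum_weight_log_ite_eq {ι : Type*} [DecidableEq ι] {s u : Finset ι} (hus : u ⊆ s)
    (w y : ι → ℝ) :
    ∑ j ∈ s, w j • (if j ∈ u then log (y j) else 0) = ∑ j ∈ u, w j * log (y j) := by
  simp only [smul_eq_mul, mul_ite, mul_zero]
  rw [sum_ite_mem, inter_eq_right.mpr hus]

lemma sum_weight_exp_log_ite_eq {ι : Type*} [DecidableEq ι] {s u : Finset ι} (hus : u ⊆ s)
    {w y : ι → ℝ} (hw1 : ∑ j ∈ s, w j = 1) (hy : ∀ j ∈ u, 0 < y j) :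
    ∑ j ∈ s, w j • exp (if j ∈ u then log (y j) else 0)
      = 1 + ∑ j ∈ u, w j * (y j - 1) := by
  rw [← sum_weight_ite_eq hus hw1]
  refine sum_congr rfl fun j _ => ?_
  split_ifs with hj
  · rw [exp_log (hy j hj), smul_eq_mul]
  · rw [exp_zero, smul_eq_mul]

/-- Jensen's inequality for `exp` at points that are `log (y j)` on `u` and `0` off `u`. -/
lemma exp_sum_mul_log_le {ι : Type*} [DecidableEq ι] {s u : Finset ι} (hus : u ⊆ s)
    {w y : ι → ℝ} (hw : ∀ j ∈ s, 0 ≤ w j) (hw1 : ∑ j ∈ s, w j = 1) (hy : ∀ j ∈ u, 0 < y j) :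
    exp (∑ j ∈ u, w j * log (y j)) ≤ 1 + ∑ j ∈ u, w j * (y j - 1) := by
  rw [← sum_weight_exp_log_ite_eq hus hw1 hy, ← sum_weight_log_ite_eq hus]
  exact convexOn_exp.map_sum_le hw hw1 fun _ _ => Set.mem_univ _

/-- Strict form of `exp_sum_mul_log_le` when `u` is a nonempty proper subset of `s`. -/
lemma exp_sum_mul_log_lt {ι : Type*} [DecidableEq ι] {s u : Finset ι} (hus : u ⊂ s)
    (hu : u.Nonempty) {w y : ι → ℝ} (hw : ∀ j ∈ s, 0 < w j) (hw1 : ∑ j ∈ s, w j = 1)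
    (hy : ∀ j ∈ u, 1 < y j) :
    exp (∑ j ∈ u, w j * log (y j)) < 1 + ∑ j ∈ u, w j * (y j - 1) := by
  obtain ⟨i, hi⟩ := hu
  obtain ⟨k, hks, hku⟩ := exists_of_ssubset hus
  rw [← sum_weight_exp_log_ite_eq hus.1 hw1 fun j hj => one_pos.trans (hy j hj),
    ← sum_weight_log_ite_eq hus.1]
  refine strictConvexOn_exp.map_sum_lt hw hw1 (fun _ _ => Set.mem_univ _)
    ⟨i, hus.1 hi, k, hks, ?_⟩
  rw [if_pos hi, if_neg hku]
  exact (log_pos (hy i hi)).ne'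

lemma two_rpow_sum_div_eq {ι : Type*} {u : Finset ι} {c y : ι → ℝ} {S : ℝ}
    (hy : ∀ j ∈ u, 1 < y j) :
    (2 : ℝ) ^ ((∑ j ∈ u, c j) / S)
      = exp (∑ j ∈ u, (c j / logb 2 (y j) / S) * log (y j)) := by
  rw [rpow_def_of_pos two_pos, sum_div, mul_sum]
  congr 1
  refine sum_congr rfl fun j hj => ?_
  have hlog : log (y j) ≠ 0 := (log_pos (hy j hj)).ne'
  rw [logb]
  field_simp

lemma sum_choose_sub_eq (K t i : ℕ) (hi : i ≤ K) :
    (K.choose (t + 1) : ℝ) - ((K - i).choose (t + 1) : ℝ)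
      = ∑ j ∈ Icc 1 i, ((K - j).choose t : ℝ) := by
  induction i with
  | zero => simp
  | succ i ih =>
    rw [sum_Icc_succ_top (by omega), ← ih (by omega),
      show K - i = (K - (i + 1)) + 1 by omega, Nat.choose_succ_succ]
    push_cast
    ring

lemma abel_sum_Icc (a q : ℕ → ℝ) (m : ℕ) :
    ∑ i ∈ Icc 1 m, (a i - a (i + 1)) * (1 + ∑ j ∈ Icc 1 i, q j)
      + a (m + 1) * (1 + ∑ j ∈ Icc 1 (m + 1), q j)
      = a 1 + ∑ j ∈ Icc 1 (m + 1), a j * q j := by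
  induction m with
  | zero => simp; ring
  | succ m ih =>
    rw [sum_Icc_succ_top (by omega : 1 ≤ m + 1),
      sum_Icc_succ_top (by omega : 1 ≤ m + 1 + 1) (fun j => a j * q j), ← add_assoc, ← ih,
      sum_Icc_succ_top (by omega : 1 ≤ m + 1 + 1)]
    ring

lemma exists_lt_succ_of_not_all_eq {m : ℕ} {h : ℕ → ℝ}
    (hmono : ∀ i ∈ Icc 1 m, h i ≤ h (i + 1))
    (hne : ¬ ∀ i ∈ Icc 1 (m + 1), h i = h 1) : ∃ k ∈ Icc 1 m, h k < h (k + 1) := by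
  by_contra! hcon
  refine hne fun i hi => ?_
  obtain ⟨h1, h2⟩ := mem_Icc.mp hi
  induction i, h1 using Nat.le_induction with
  | base => rfl
  | succ i h1 ih =>
    have him : i ∈ Icc 1 m := mem_Icc.mpr ⟨h1, by omega⟩
    exact ((hcon i him).antisymm (hmono i him)).trans
      (ih (mem_Icc.mpr ⟨h1, by omega⟩) (by omega))

/-- The normalised power of the concurrent scheme, run for the time `S` the orthogonal scheme
needs to deliver loads `c j` over channels of gains `h j`, is less than one. -/
lemma concurrent_power_lt {m : ℕ} {c h : ℕ → ℝ} {S : ℝ}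
    (hS : S = ∑ j ∈ Icc 1 (m + 1), c j / logb 2 (1 + h j ^ 2))
    (hc : ∀ j ∈ Icc 1 (m + 1), 0 < c j) (hpos : ∀ j ∈ Icc 1 (m + 1), 0 < h j)
    (hmono : ∀ i ∈ Icc 1 m, h i ≤ h (i + 1))
    (hne : ¬ ∀ i ∈ Icc 1 (m + 1), h i = h 1) :
    ∑ i ∈ Icc 1 m, (1 / h i ^ 2 - 1 / h (i + 1) ^ 2) * (2 : ℝ) ^ ((∑ j ∈ Icc 1 i, c j) / S)
      + 1 / h (m + 1) ^ 2 * (2 : ℝ) ^ ((∑ j ∈ Icc 1 (m + 1), c j) / S)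
      < 1 / h 1 ^ 2 + 1 := by
  obtain ⟨k, hk, hlt⟩ := exists_lt_succ_of_not_all_eq hmono hne
  have hy : ∀ j ∈ Icc 1 (m + 1), 1 < 1 + h j ^ 2 := fun j hj => by
    have := hpos j hj
    linarith [pow_pos this 2]
  have hterm : ∀ j ∈ Icc 1 (m + 1), 0 < c j / logb 2 (1 + h j ^ 2) := fun j hj =>
    div_pos (hc j hj) (logb_pos one_lt_two (hy j hj))
  have hSpos : 0 < S := hS ▸ sum_pos hterm ⟨1, by simp⟩
  set w : ℕ → ℝ := fun j => c j / logb 2 (1 + h j ^ 2) / S with hw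
  have hwpos : ∀ j ∈ Icc 1 (m + 1), 0 < w j := fun j hj => div_pos (hterm j hj) hSpos
  have hw1 : ∑ j ∈ Icc 1 (m + 1), w j = 1 := by
    rw [hw, ← sum_div, ← hS, div_self hSpos.ne']
  have hbound : ∀ i ≤ m + 1, (2 : ℝ) ^ ((∑ j ∈ Icc 1 i, c j) / S)
      ≤ 1 + ∑ j ∈ Icc 1 i, w j * h j ^ 2 := fun i hi => by
    have hsub : Icc 1 i ⊆ Icc 1 (m + 1) := Icc_subset_Icc_right hi
    rw [two_rpow_sum_div_eq fun j hj => hy j (hsub hj)]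
    simpa using exp_sum_mul_log_le hsub (fun j hj => (hwpos j hj).le) hw1
      fun j hj => one_pos.trans (hy j (hsub hj))
  have hstrict : (2 : ℝ) ^ ((∑ j ∈ Icc 1 k, c j) / S)
      < 1 + ∑ j ∈ Icc 1 k, w j * h j ^ 2 := by
    obtain ⟨hk1, hkm⟩ := mem_Icc.mp hk
    have hsub : Icc 1 k ⊂ Icc 1 (m + 1) :=
      Icc_ssubset_Icc_right (by omega) le_rfl (by omega)
    rw [two_rpow_sum_div_eq fun j hj => hy j (hsub.1 hj)]
    simpa using exp_sum_mul_log_lt hsub ⟨1, mem_Icc.mpr ⟨le_rfl, hk1⟩⟩ hwpos hw1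
      fun j hj => hy j (hsub.1 hj)
  have hcoef : ∀ i ∈ Icc 1 m, 0 ≤ 1 / h i ^ 2 - 1 / h (i + 1) ^ 2 := fun i hi => by
    obtain ⟨hi1, him⟩ := mem_Icc.mp hi
    have hp := hpos i (mem_Icc.mpr ⟨hi1, by omega⟩)
    exact sub_nonneg.mpr (one_div_le_one_div_of_le (pow_pos hp 2)
      (pow_le_pow_left₀ hp.le (hmono i hi) 2))
  have hcoefk : 0 < 1 / h k ^ 2 - 1 / h (k + 1) ^ 2 := by
    obtain ⟨hk1, hkm⟩ := mem_Icc.mp hk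
    have hp := hpos k (mem_Icc.mpr ⟨hk1, by omega⟩)
    exact sub_pos.mpr (one_div_lt_one_div_of_lt (pow_pos hp 2)
      (pow_lt_pow_left₀ hlt hp.le two_ne_zero))
  have hunit : ∑ j ∈ Icc 1 (m + 1), 1 / h j ^ 2 * (w j * h j ^ 2) = 1 := by
    refine (sum_congr rfl fun j hj => ?_).trans hw1
    have := (hpos j hj).ne'
    field_simp
  have habel := abel_sum_Icc (fun i => 1 / h i ^ 2) (fun j => w j * h j ^ 2) m
  rw [hunit] at habel
  rw [← habel]
  refine add_lt_add_of_lt_of_le (sum_lt_sum (fun i hi => ?_) ⟨k, hk, ?_⟩) ?_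
  · exact mul_le_mul_of_nonneg_left (hbound i (by have := mem_Icc.mp hi; omega)) (hcoef i hi)
  · exact mul_lt_mul_of_pos_left hstrict hcoefk
  · exact mul_le_mul_of_nonneg_left (hbound _ le_rfl) (by positivity)

/-- With equal gains, the concurrent scheme run for the orthogonal delivery time uses exactly
unit power. -/
lemma concurrent_power_eq {m : ℕ} {c h : ℕ → ℝ} {S : ℝ}
    (hS : S = ∑ j ∈ Icc 1 (m + 1), c j / logb 2 (1 + h j ^ 2))
    (hc : ∀ j ∈ Icc 1 (m + 1), 0 < c j) (hpos : 0 < h 1)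
    (heq : ∀ i ∈ Icc 1 (m + 1), h i = h 1) :
    ∑ i ∈ Icc 1 m, (1 / h i ^ 2 - 1 / h (i + 1) ^ 2) * (2 : ℝ) ^ ((∑ j ∈ Icc 1 i, c j) / S)
      + 1 / h (m + 1) ^ 2 * (2 : ℝ) ^ ((∑ j ∈ Icc 1 (m + 1), c j) / S)
      = 1 / h 1 ^ 2 + 1 := by
  have hsq : 0 < h 1 ^ 2 := pow_pos hpos 2
  have hCpos : 0 < ∑ j ∈ Icc 1 (m + 1), c j := sum_pos hc ⟨1, by simp⟩
  have hlog : 0 < logb 2 (1 + h 1 ^ 2) := logb_pos one_lt_two (by linarith)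
  have hS' : S = (∑ j ∈ Icc 1 (m + 1), c j) / logb 2 (1 + h 1 ^ 2) := by
    rw [hS, sum_div]
    exact sum_congr rfl fun j hj => by rw [heq j hj]
  rw [sum_eq_zero, hS', div_div_cancel₀ hCpos.ne',
    rpow_logb two_pos (by norm_num) (by linarith), heq (m + 1) (by simp)]
  · field_simp
    ring
  · intro i hi
    obtain ⟨hi1, him⟩ := mem_Icc.mp hi
    rw [heq i (mem_Icc.mpr ⟨hi1, by omega⟩), heq (i + 1) (mem_Icc.mpr ⟨by omega, by omega⟩),
      sub_self, zero_mul]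

/-- Equality condition for Theorem 5 of the paper: the concurrent and orthogonal
delivery times of the centralized scheme coincide (i.e. `g_c(T_{c,o}) = 0`) exactly
when all channel gains are equal; if `K - t ≥ 2` and the gains are not all equal then
`g_c(T_{c,o}) < 0`, i.e. the root of `g_c` is strictly smaller than `T_{c,o}`. -/
theorem gc_at_Tco_eq_zero_iff_equal_gains
    (K t : ℕ) (ht : 1 ≤ t) (htK : t < K) (h : ℕ → ℝ)
    (hpos : ∀ i ∈ Finset.Icc 1 (K - t), 0 < h i)
    (hmono : ∀ i ∈ Finset.Icc 1 (K - t - 1), h i ≤ h (i + 1)) :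
    let Tco : ℝ := (1 / (K.choose t : ℝ)) *
      ∑ i ∈ Finset.Icc 1 (K - t),
        ((K - i).choose t : ℝ) / Real.logb 2 (1 + (h i) ^ 2)
    let g : ℝ → ℝ := fun s =>
      ∑ i ∈ Finset.Icc 1 (K - t - 1),
        (1 / (h i) ^ 2 - 1 / (h (i + 1)) ^ 2) *
          (2 : ℝ) ^ (((K.choose (t + 1) : ℝ) - ((K - i).choose (t + 1) : ℝ)) /
            ((K.choose t : ℝ) * s))
      + (1 / (h (K - t)) ^ 2) *
          (2 : ℝ) ^ ((K.choose (t + 1) : ℝ) / ((K.choose t : ℝ) * s))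
      - 1 / (h 1) ^ 2 - 1
    ((∀ i ∈ Finset.Icc 1 (K - t), h i = h 1) → g Tco = 0) ∧
    (2 ≤ K - t → ¬ (∀ i ∈ Finset.Icc 1 (K - t), h i = h 1) → g Tco < 0) := by
  intro Tco g
  obtain ⟨m, hm⟩ : ∃ m, K - t = m + 1 := ⟨K - t - 1, by omega⟩
  have hchoose : (K.choose t : ℝ) ≠ 0 := by
    exact_mod_cast (Nat.choose_pos htK.le).ne'
  have hS : (K.choose t : ℝ) * Tco
      = ∑ j ∈ Icc 1 (m + 1), ((K - j).choose t : ℝ) / logb 2 (1 + h j ^ 2) := by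
    simp only [Tco, hm]
    rw [← mul_assoc, mul_one_div_cancel hchoose, one_mul]
  have hc : ∀ j ∈ Icc 1 (m + 1), (0 : ℝ) < ((K - j).choose t : ℝ) := fun j hj => by
    have := mem_Icc.mp hj
    exact_mod_cast Nat.choose_pos (by omega)
  have hg : g Tco = ∑ i ∈ Icc 1 m, (1 / h i ^ 2 - 1 / h (i + 1) ^ 2) *
        (2 : ℝ) ^ ((∑ j ∈ Icc 1 i, ((K - j).choose t : ℝ)) / ((K.choose t : ℝ) * Tco))
      + 1 / h (m + 1) ^ 2 * (2 : ℝ) ^ ((∑ j ∈ Icc 1 (m + 1), ((K - j).choose t : ℝ)) /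
          ((K.choose t : ℝ) * Tco)) - 1 / h 1 ^ 2 - 1 := by
    have htop : (K.choose (t + 1) : ℝ) = ∑ j ∈ Icc 1 (m + 1), ((K - j).choose t : ℝ) := by
      rw [← sum_choose_sub_eq K t (m + 1) (by omega), show K - (m + 1) = t by omega,
        Nat.choose_succ_self, Nat.cast_zero, sub_zero]
    have hsum : ∀ i ∈ Icc 1 m, (K.choose (t + 1) : ℝ) - ((K - i).choose (t + 1) : ℝ)
        = ∑ j ∈ Icc 1 i, ((K - j).choose t : ℝ) := fun i hi =>
      sum_choose_sub_eq K t i (by have := mem_Icc.mp hi; omega)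
    simp only [g, hm, Nat.add_sub_cancel]
    rw [sum_congr rfl fun i hi => by rw [hsum i hi], htop]
  rw [hm] at hpos hmono ⊢
  rw [Nat.add_sub_cancel] at hmono
  rw [hg]
  refine ⟨fun heq => ?_, fun _ hne => ?_⟩
  · linarith [concurrent_power_eq hS hc (hpos 1 (by simp)) heq]
  · linarith [concurrent_power_lt hS hc hpos hmono hne]
end

section
/- Let K be a positive integer, let q ∈ (0,1), and let 0 < h_1 ≤ h_2 ≤ ... ≤ h_K be real channel gains. Define T_{d,o} = Σ_{i=1}^{K} (1−q)^i / log₂(1+h_i^2) and g_d(s) = Σ_{i=1}^{K−1} (1/h_i^2 − 1/h_{i+1}^2)·2^{(1−q)(1−(1−q)^i)/(q·s)} + (1/h_K^2)·2^{(1−q)(1−(1−q)^K)/(q·s)} − 1/h_1^2 − 1. Then g_d(T_{d,o}) ≤ 0; consequently, every s* > 0 with g_d(s*) = 0 satisfies s* ≤ T_{d,o}. -/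
open Finset Real

/-- The secant slope from `1` to `1 + y` of the concave function `x ↦ x ^ p`, `0 ≤ p ≤ 1`,
is antitone in `y`. -/
lemma one_add_rpow_sub_one_div_antitone {y z p : ℝ} (hy : 0 < y) (hyz : y ≤ z)
    (hp0 : 0 ≤ p) (hp1 : p ≤ 1) :
    1 / z * ((1 + z) ^ p - 1) ≤ 1 / y * ((1 + y) ^ p - 1) := by
  have hz : 0 < z := hy.trans_le hyz
  have ht : 0 ≤ 1 - y / z := by
    rw [sub_nonneg, div_le_one hz]
    exact hyz
  have hconc := (Real.concaveOn_rpow hp0 hp1).2 (Set.mem_Ici.2 zero_le_one)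
    (Set.mem_Ici.2 (by positivity : 0 ≤ 1 + z)) ht (div_nonneg hy.le hz.le) (by ring)
  have hpoint : (1 - y / z) * 1 + y / z * (1 + z) = 1 + y := by field_simp; ring
  simp only [smul_eq_mul, hpoint, Real.one_rpow] at hconc
  calc 1 / z * ((1 + z) ^ p - 1) = 1 / y * (y / z * ((1 + z) ^ p - 1)) := by
        field_simp
    _ ≤ 1 / y * ((1 + y) ^ p - 1) := by
        gcongr
        linarith

/-- Replacing all gains beyond the first `n` by the gain `y (n + 1)`, the weighted sum of the
partial products `∏ (1 + y j) ^ w j` stays below its value for constant gains. -/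
lemma sum_mul_prod_one_add_rpow_le (y w : ℕ → ℝ) (n : ℕ)
    (hy : ∀ i ∈ Finset.Icc 1 (n + 1), 0 < y i)
    (hmono : ∀ i ∈ Finset.Icc 1 n, y i ≤ y (i + 1))
    (hw : ∀ i ∈ Finset.Icc 1 n, 0 ≤ w i) (hsum : ∑ i ∈ Finset.Icc 1 n, w i ≤ 1) :
    ∑ i ∈ Finset.Icc 1 n,
        (1 / y i - 1 / y (i + 1)) * ∏ j ∈ Finset.Icc 1 i, (1 + y j) ^ w j
      + 1 / y (n + 1) * ((∏ j ∈ Finset.Icc 1 n, (1 + y j) ^ w j)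
        * (1 + y (n + 1)) ^ (1 - ∑ i ∈ Finset.Icc 1 n, w i)) ≤ 1 / y 1 + 1 := by
  induction n with
  | zero =>
    have h1 : 0 < y 1 := hy 1 (by simp)
    simp only [zero_add, Finset.Icc_eq_empty_of_lt zero_lt_one, Finset.sum_empty,
      Finset.prod_empty, sub_zero, Real.rpow_one, one_mul]
    field_simp
    rfl
  | succ n ih =>
    have hyn : 0 < y (n + 1) := hy _ (by simp)
    have hwn : 0 ≤ w (n + 1) := hw _ (by simp)
    have hprev : Finset.Icc 1 n ⊆ Finset.Icc 1 (n + 1) :=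
      Finset.Icc_subset_Icc_right n.le_succ
    have hsum_nonneg : 0 ≤ ∑ i ∈ Finset.Icc 1 n, w i :=
      Finset.sum_nonneg fun i hi => hw i (hprev hi)
    have hprod_pos : 0 < ∏ j ∈ Finset.Icc 1 (n + 1), (1 + y j) ^ w j :=
      Finset.prod_pos fun j hj => Real.rpow_pos_of_pos
        (by linarith [hy j (Finset.Icc_subset_Icc_right (Nat.le_succ _) hj)]) _
    have hsucc := Finset.sum_Icc_succ_top (Nat.succ_le_succ n.zero_le) w
    have ih := ih (fun i hi => hy i (Finset.Icc_subset_Icc_right (Nat.le_succ _) hi))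
      (fun i hi => hmono i (hprev hi)) (fun i hi => hw i (hprev hi)) (by linarith)
    have hslope := one_add_rpow_sub_one_div_antitone hyn (hmono (n + 1) (by simp))
      (p := 1 - ∑ i ∈ Finset.Icc 1 (n + 1), w i) (by linarith) (by linarith)
    have hsplit : (∏ j ∈ Finset.Icc 1 n, (1 + y j) ^ w j)
          * (1 + y (n + 1)) ^ (1 - ∑ i ∈ Finset.Icc 1 n, w i)
        = (∏ j ∈ Finset.Icc 1 (n + 1), (1 + y j) ^ w j)
          * (1 + y (n + 1)) ^ (1 - ∑ i ∈ Finset.Icc 1 (n + 1), w i) := by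
      rw [Finset.prod_Icc_succ_top (Nat.succ_le_succ n.zero_le), mul_assoc,
        ← Real.rpow_add (by linarith), hsucc]
      congr 2
      ring
    rw [hsplit] at ih
    rw [Finset.sum_Icc_succ_top (Nat.succ_le_succ n.zero_le)]
    have := mul_le_mul_of_nonneg_left hslope hprod_pos.le
    linarith

lemma sum_Icc_one_geom {q : ℝ} (hq : q ≠ 0) (n : ℕ) :
    ∑ i ∈ Finset.Icc 1 n, (1 - q) ^ i = (1 - q) * (1 - (1 - q) ^ n) / q := by
  induction n with
  | zero => simp
  | succ n ih =>
    rw [Finset.sum_Icc_succ_top (Nat.succ_le_succ n.zero_le), ih]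
    field_simp
    ring

/-- Theorem 6 of the paper: in the decentralized scheme, the transmission time of the
concurrent delivery scheme (the unique positive root of `g_d`) is no larger than the
transmission time `T_{d,o}` of the orthogonal delivery scheme; equivalently
`g_d(T_{d,o}) ≤ 0`. -/
theorem gd_at_Tdo_nonpos
    (K : ℕ) (hK : 1 ≤ K) (q : ℝ) (hq : q ∈ Set.Ioo (0 : ℝ) 1) (h : ℕ → ℝ)
    (hpos : ∀ i ∈ Finset.Icc 1 K, 0 < h i)
    (hmono : ∀ i ∈ Finset.Icc 1 (K - 1), h i ≤ h (i + 1)) :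
    let Tdo : ℝ := ∑ i ∈ Finset.Icc 1 K,
      (1 - q) ^ i / Real.logb 2 (1 + (h i) ^ 2)
    let g : ℝ → ℝ := fun s =>
      ∑ i ∈ Finset.Icc 1 (K - 1),
        (1 / (h i) ^ 2 - 1 / (h (i + 1)) ^ 2) *
          (2 : ℝ) ^ ((1 - q) * (1 - (1 - q) ^ i) / (q * s))
      + (1 / (h K) ^ 2) * (2 : ℝ) ^ ((1 - q) * (1 - (1 - q) ^ K) / (q * s))
      - 1 / (h 1) ^ 2 - 1
    g Tdo ≤ 0 ∧ ∀ s : ℝ, 0 < s → g s = 0 → s ≤ Tdo := by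
  intro Tdo g
  obtain ⟨hq0, hq1⟩ := hq
  have hq1' : 0 < 1 - q := by linarith
  obtain ⟨n, rfl⟩ : ∃ n, K = n + 1 := ⟨K - 1, by omega⟩
  simp only [Nat.add_sub_cancel] at hmono
  have hlog : ∀ i ∈ Finset.Icc 1 (n + 1), 0 < Real.logb 2 (1 + h i ^ 2) := fun i hi =>
    Real.logb_pos one_lt_two (by have := pow_pos (hpos i hi) 2; linarith)
  have hT : 0 < Tdo := Finset.sum_pos
    (fun i hi => div_pos (pow_pos hq1' i) (hlog i hi)) ⟨1, by simp⟩
  have hsub : Finset.Icc 1 n ⊆ Finset.Icc 1 (n + 1) := Finset.Icc_subset_Icc_right n.le_succ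
  have hsq : ∀ i ∈ Finset.Icc 1 n, h i ^ 2 ≤ h (i + 1) ^ 2 := fun i hi =>
    pow_le_pow_left₀ (hpos i (hsub hi)).le (hmono i hi) 2
  have hcoef : ∀ i ∈ Finset.Icc 1 n, 0 ≤ 1 / h i ^ 2 - 1 / h (i + 1) ^ 2 := fun i hi =>
    sub_nonneg.2 (one_div_le_one_div_of_le (pow_pos (hpos i (hsub hi)) 2) (hsq i hi))
  have hnum : ∀ i, 0 ≤ (1 - q) * (1 - (1 - q) ^ i) := fun i =>
    mul_nonneg hq1'.le (sub_nonneg.2 (pow_le_one₀ hq1'.le (by linarith)))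
  have hgT : g Tdo ≤ 0 := by
    set w : ℕ → ℝ := fun i => (1 - q) ^ i / Real.logb 2 (1 + h i ^ 2) / Tdo with hw_def
    have hw : ∀ i ∈ Finset.Icc 1 (n + 1), 0 ≤ w i := fun i hi =>
      div_nonneg (div_nonneg (pow_nonneg hq1'.le i) (hlog i hi).le) hT.le
    have hw_sum : ∑ i ∈ Finset.Icc 1 (n + 1), w i = 1 := by
      rw [hw_def, ← Finset.sum_div]
      exact div_self hT.ne'
    have hprod : ∀ i ∈ Finset.Icc 1 (n + 1),
        (2 : ℝ) ^ ((1 - q) * (1 - (1 - q) ^ i) / (q * Tdo))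
          = ∏ j ∈ Finset.Icc 1 i, (1 + h j ^ 2) ^ w j := by
      intro i hi
      rw [← div_div, ← sum_Icc_one_geom hq0.ne', Finset.sum_div,
        Real.rpow_sum_of_pos two_pos]
      refine Finset.prod_congr rfl fun j hj => ?_
      have hj' : j ∈ Finset.Icc 1 (n + 1) :=
        Finset.Icc_subset_Icc_right (Finset.mem_Icc.1 hi).2 hj
      have hexp : (1 - q) ^ j / Tdo = Real.logb 2 (1 + h j ^ 2) * w j := by
        have := (hlog j hj').ne'
        simp only [hw_def]
        field_simp
      rw [hexp, Real.rpow_mul two_pos.le,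
        Real.rpow_logb two_pos (by norm_num) (by positivity)]
    have hw_succ := Finset.sum_Icc_succ_top (Nat.succ_le_succ n.zero_le) w
    have hlast := hw (n + 1) (by simp)
    have key := sum_mul_prod_one_add_rpow_le (fun i => h i ^ 2) w n
      (fun i hi => pow_pos (hpos i hi) 2) hsq (fun i hi => hw i (hsub hi)) (by linarith)
    have hrest : 1 - ∑ i ∈ Finset.Icc 1 n, w i = w (n + 1) := by linarith
    rw [hrest, ← Finset.prod_Icc_succ_top (Nat.succ_le_succ n.zero_le)
      (fun j => (1 + h j ^ 2) ^ w j)] at key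
    simp only [g, Nat.add_sub_cancel]
    rw [hprod (n + 1) (by simp),
      Finset.sum_congr rfl fun i hi => by rw [hprod i (hsub hi)]]
    linarith
  refine ⟨hgT, fun s hs hgs => ?_⟩
  by_contra! hlt
  have hden : q * Tdo < q * s := mul_lt_mul_of_pos_left hlt hq0
  have hqT : 0 < q * Tdo := mul_pos hq0 hT
  have hsum_le : ∑ i ∈ Finset.Icc 1 n, (1 / (h i) ^ 2 - 1 / (h (i + 1)) ^ 2) *
        (2 : ℝ) ^ ((1 - q) * (1 - (1 - q) ^ i) / (q * s))
      ≤ ∑ i ∈ Finset.Icc 1 n, (1 / (h i) ^ 2 - 1 / (h (i + 1)) ^ 2) *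
        (2 : ℝ) ^ ((1 - q) * (1 - (1 - q) ^ i) / (q * Tdo)) :=
    Finset.sum_le_sum fun i hi => mul_le_mul_of_nonneg_left
      (Real.rpow_le_rpow_of_exponent_le one_le_two
        (div_le_div_of_nonneg_left (hnum i) hqT hden.le)) (hcoef i hi)
  have hnum_pos : 0 < (1 - q) * (1 - (1 - q) ^ (n + 1)) :=
    mul_pos hq1' (sub_pos.2 (pow_lt_one₀ hq1'.le (by linarith) n.succ_ne_zero))
  have hlast_lt : 1 / h (n + 1) ^ 2 *
        (2 : ℝ) ^ ((1 - q) * (1 - (1 - q) ^ (n + 1)) / (q * s))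
      < 1 / h (n + 1) ^ 2 *
        (2 : ℝ) ^ ((1 - q) * (1 - (1 - q) ^ (n + 1)) / (q * Tdo)) :=
    mul_lt_mul_of_pos_left (Real.rpow_lt_rpow_of_exponent_lt one_lt_two
      (div_lt_div_of_pos_left hnum_pos hqT hden))
      (one_div_pos.2 (pow_pos (hpos (n + 1) (by simp)) 2))
  simp only [g, Nat.add_sub_cancel] at hgT hgs
  linarith
end

section
/- Let K be a positive integer, let q ∈ (0,1), and let 0 < h_1 ≤ h_2 ≤ ... ≤ h_K be real channel gains. Define T_{d,o} = Σ_{i=1}^{K} (1−q)^i / log₂(1+h_i^2) and g_d(s) = Σ_{i=1}^{K−1} (1/h_i^2 − 1/h_{i+1}^2)·2^{(1−q)(1−(1−q)^i)/(q·s)} + (1/h_K^2)·2^{(1−q)(1−(1−q)^K)/(q·s)} − 1/h_1^2 − 1. If h_1 = h_2 = ... = h_K, then g_d(T_{d,o}) = 0, i.e., the unique positive root of g_d equals T_{d,o}; conversely, if K ≥ 2 and the gains are not all equal, then g_d(T_{d,o}) < 0, i.e., the unique positive root of g_d is strictly smaller than T_{d,o}. -/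
open Finset Real

/-- The slope of the strictly concave function `x ↦ x ^ σ` between `1` and `1 + u` strictly
decreases in `u`. -/
lemma one_div_mul_rpow_sub_one_lt {σ u v : ℝ} (hσ0 : 0 < σ) (hσ1 : σ < 1) (hu : 0 < u)
    (huv : u < v) :
    1 / v * ((1 + v) ^ σ - 1) < 1 / u * ((1 + u) ^ σ - 1) := by
  simpa [div_eq_inv_mul] using (Real.strictConcaveOn_rpow hσ0 hσ1).secant_strict_mono
    (a := 1) (x := 1 + u) (y := 1 + v) (by simp) (Set.mem_Ici.2 (by linarith))
    (Set.mem_Ici.2 (by linarith)) (by linarith) (by linarith) (by linarith)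

/-- Telescoping identity for the weighted sum that defines the delivery equation. -/
lemma sum_sub_mul_add_eq (a x E τ : ℕ → ℝ) (hE0 : E 0 = 1) (hτ0 : τ 0 = 0) (n : ℕ)
    (hx : ∀ i ∈ Icc 1 (n + 1), 0 < x i)
    (hE : ∀ i ≤ n, E (i + 1) = E i * x (i + 1) ^ (τ (i + 1) - τ i)) :
    ∑ i ∈ Icc 1 n, (a i - a (i + 1)) * E i
        + a (n + 1) * (E (n + 1) * x (n + 1) ^ (1 - τ (n + 1)))
      = a 1 * x 1 + ∑ i ∈ Icc 1 n, E i *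
        (a (i + 1) * (x (i + 1) ^ (1 - τ i) - 1) - a i * (x i ^ (1 - τ i) - 1)) := by
  have key : ∀ i ≤ n,
      E (i + 1) * x (i + 1) ^ (1 - τ (i + 1)) = E i * x (i + 1) ^ (1 - τ i) := by
    intro i hi
    rw [hE i hi, mul_assoc, ← rpow_add (hx (i + 1) (by simp; omega))]
    ring_nf
  induction n with
  | zero =>
    have := key 0 le_rfl
    simp only [zero_add, hE0, hτ0, sub_zero, rpow_one, one_mul] at this
    simp [this]
  | succ n ih =>
    have ih := ih (fun i hi => hx i (by simp at hi ⊢; omega)) (fun i hi => hE i (by omega))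
      (fun i hi => key i (by omega))
    rw [sum_Icc_succ_top (by omega), sum_Icc_succ_top (by omega), key (n + 1) le_rfl]
    linear_combination ih

/-- Equality condition for Theorem 6 of the paper: the concurrent and orthogonal
delivery times of the decentralized scheme coincide (i.e. `g_d(T_{d,o}) = 0`) exactly
when all channel gains are equal; if `K ≥ 2` and the gains are not all equal then
`g_d(T_{d,o}) < 0`, i.e. the root of `g_d` is strictly smaller than `T_{d,o}`. -/
theorem gd_at_Tdo_eq_zero_iff_equal_gains
    (K : ℕ) (hK : 1 ≤ K) (q : ℝ) (hq : q ∈ Set.Ioo (0 : ℝ) 1) (h : ℕ → ℝ)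
    (hpos : ∀ i ∈ Finset.Icc 1 K, 0 < h i)
    (hmono : ∀ i ∈ Finset.Icc 1 (K - 1), h i ≤ h (i + 1)) :
    let Tdo : ℝ := ∑ i ∈ Finset.Icc 1 K,
      (1 - q) ^ i / Real.logb 2 (1 + (h i) ^ 2)
    let g : ℝ → ℝ := fun s =>
      ∑ i ∈ Finset.Icc 1 (K - 1),
        (1 / (h i) ^ 2 - 1 / (h (i + 1)) ^ 2) *
          (2 : ℝ) ^ ((1 - q) * (1 - (1 - q) ^ i) / (q * s))
      + (1 / (h K) ^ 2) * (2 : ℝ) ^ ((1 - q) * (1 - (1 - q) ^ K) / (q * s))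
      - 1 / (h 1) ^ 2 - 1
    ((∀ i ∈ Finset.Icc 1 K, h i = h 1) → g Tdo = 0) ∧
    (2 ≤ K → ¬ (∀ i ∈ Finset.Icc 1 K, h i = h 1) → g Tdo < 0) := by
  intro Tdo g
  obtain ⟨hq0, hq1⟩ := hq
  obtain ⟨n, rfl⟩ : ∃ n, K = n + 1 := ⟨K - 1, by omega⟩
  simp only [Nat.add_sub_cancel] at hmono
  have hp : 0 < 1 - q := by linarith
  set x : ℕ → ℝ := fun i => 1 + h i ^ 2 with hx
  set w : ℕ → ℝ := fun i => (1 - q) ^ i / Real.logb 2 (x i) with hw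
  have hx1 : ∀ i ∈ Icc 1 (n + 1), 1 < x i := fun i hi => by
    have := pow_pos (hpos i hi) 2
    simp only [hx]; linarith
  have hlog : ∀ i ∈ Icc 1 (n + 1), 0 < Real.logb 2 (x i) := fun i hi =>
    Real.logb_pos (by norm_num) (hx1 i hi)
  have hwpos : ∀ i ∈ Icc 1 (n + 1), 0 < w i := fun i hi => div_pos (pow_pos hp i) (hlog i hi)
  have hTw : Tdo = ∑ i ∈ Icc 1 (n + 1), w i := rfl
  have hT : 0 < Tdo := hTw ▸ sum_pos hwpos ⟨1, by simp⟩
  set τ : ℕ → ℝ := fun m => (∑ i ∈ Icc 1 m, w i) / Tdo with hτ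
  set E : ℕ → ℝ := fun i => (2 : ℝ) ^ ((1 - q) * (1 - (1 - q) ^ i) / (q * Tdo)) with hE
  have hτK : τ (n + 1) = 1 := by simp only [hτ, ← hTw]; exact div_self hT.ne'
  have hstep : ∀ i ≤ n, E (i + 1) = E i * x (i + 1) ^ (τ (i + 1) - τ i) := by
    intro i hi
    have hmem : i + 1 ∈ Icc 1 (n + 1) := by simp; omega
    have hl := hlog _ hmem
    have ht : τ (i + 1) - τ i = w (i + 1) / Tdo := by
      simp only [hτ]
      rw [sum_Icc_succ_top (by omega)]
      ring
    have hxe : x (i + 1) ^ (w (i + 1) / Tdo) = (2 : ℝ) ^ ((1 - q) ^ (i + 1) / Tdo) := by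
      conv_lhs => rw [← Real.rpow_logb (b := 2) (by norm_num) (by norm_num)
        (zero_lt_one.trans (hx1 _ hmem)), ← Real.rpow_mul (by norm_num)]
      congr 1
      simp only [hw]
      field_simp
    rw [ht, hxe]
    simp only [hE]
    rw [← Real.rpow_add (by norm_num)]
    congr 1
    field_simp
    ring
  have hg : g Tdo = ∑ i ∈ Icc 1 n, E i *
      (1 / h (i + 1) ^ 2 * (x (i + 1) ^ (1 - τ i) - 1)
        - 1 / h i ^ 2 * (x i ^ (1 - τ i) - 1)) := by
    have hid := sum_sub_mul_add_eq (fun i => 1 / h i ^ 2) x E τ (by simp [hE]) (by simp [hτ]) n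
      (fun i hi => zero_lt_one.trans (hx1 i hi)) hstep
    have h1 : 1 / h 1 ^ 2 * x 1 = 1 / h 1 ^ 2 + 1 := by
      have := hpos 1 (by simp)
      simp only [hx]
      field_simp
    rw [hτK, sub_self, Real.rpow_zero, mul_one, h1] at hid
    change ∑ i ∈ Icc 1 n, (1 / h i ^ 2 - 1 / h (i + 1) ^ 2) * E i
      + 1 / h (n + 1) ^ 2 * E (n + 1) - 1 / h 1 ^ 2 - 1 = _
    linear_combination hid
  have hEpos : ∀ i, 0 < E i := fun i => Real.rpow_pos_of_pos (by norm_num) _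
  have hmem : ∀ i ∈ Icc 1 n, i ∈ Icc 1 (n + 1) ∧ i + 1 ∈ Icc 1 (n + 1) := fun i hi => by
    simp at hi ⊢; omega
  have hlt : ∀ i ∈ Icc 1 n, h i < h (i + 1) → E i *
      (1 / h (i + 1) ^ 2 * (x (i + 1) ^ (1 - τ i) - 1)
        - 1 / h i ^ 2 * (x i ^ (1 - τ i) - 1)) < 0 := by
    intro i hi hhi
    have hin := mem_Icc.1 hi
    have hτpos : 0 < τ i := div_pos
      (sum_pos (fun j hj => hwpos j (by simp at hj ⊢; omega)) ⟨1, by simp; omega⟩) hT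
    have hτlt : τ i < 1 := by
      rw [div_lt_one hT, hTw]
      exact sum_lt_sum_of_subset (i := n + 1) (Icc_subset_Icc_right (by omega)) (by simp)
        (by simp; omega) (hwpos _ (by simp)) (fun j hj _ => (hwpos j hj).le)
    have hi0 := hpos i (hmem i hi).1
    exact mul_neg_of_pos_of_neg (hEpos i) (sub_neg.2 (one_div_mul_rpow_sub_one_lt
      (by linarith) (by linarith) (pow_pos hi0 2) (pow_lt_pow_left₀ hhi hi0.le two_ne_zero)))
  have heq : ∀ i, h i = h (i + 1) → E i *
      (1 / h (i + 1) ^ 2 * (x (i + 1) ^ (1 - τ i) - 1)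
        - 1 / h i ^ 2 * (x i ^ (1 - τ i) - 1)) = 0 := by
    intro i hi
    simp [hx, hi]
  rw [hg]
  refine ⟨fun hall => sum_eq_zero fun i hi => heq i ?_, fun _ hne => ?_⟩
  · rw [hall i (hmem i hi).1, hall (i + 1) (hmem i hi).2]
  · obtain ⟨i, hi, hii⟩ : ∃ i ∈ Icc 1 n, h i < h (i + 1) := by
      by_contra! hcon
      refine hne fun i hi => ?_
      obtain ⟨hi1, hi2⟩ := mem_Icc.1 hi
      induction i, hi1 using Nat.le_induction with
      | base => rfl
      | succ i hi1 ih =>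
        have him : i ∈ Icc 1 n := by simp; omega
        rw [← ih (hmem i him).1 (by omega)]
        exact le_antisymm (hcon i him) (hmono i him)
    refine sum_neg' (fun j hj => ?_) ⟨i, hi, hlt i hi hii⟩
    rcases (hmono j hj).lt_or_eq with hj' | hj'
    · exact (hlt j hj hj').le
    · exact (heq j hj').le
end

section
/- Let K, t be integers with 1 ≤ t < K and let 0 < h_1 ≤ h_2 ≤ ... ≤ h_{K−t} be real channel gains. Consider the problem of minimizing s over all pairs (r, s) with r ∈ ℝ^{K−t}, r_i > 0 for all i, satisfying C(K−i,t)/(C(K,t)·r_i) ≤ s for every i ∈ {1,...,K−t} and Σ_{i=1}^{K−t−1} (1/h_i^2 − 1/h_{i+1}^2)·2^{r_1+...+r_i} + (1/h_{K−t}^2)·2^{r_1+...+r_{K−t}} − 1/h_1^2 ≤ 1, where C(n,k) denotes the binomial coefficient. Then at any optimal pair (r*, s*) all of these inequality constraints hold with equality: C(K−i,t)/(C(K,t)·r*_i) = s* for every i, and Σ_{i=1}^{K−t−1} (1/h_i^2 − 1/h_{i+1}^2)·2^{r*_1+...+r*_i} + (1/h_{K−t}^2)·2^{r*_1+...+r*_{K−t}}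 − 1/h_1^2 = 1. -/
open Finset Real

/-- The left-hand side of the power constraint for `n` users with gains `h` and rates `r`. -/
noncomputable def powerCost (h : ℕ → ℝ) (n : ℕ) (r : ℕ → ℝ) : ℝ :=
  ∑ i ∈ Finset.Icc 1 (n - 1),
      (1 / (h i) ^ 2 - 1 / (h (i + 1)) ^ 2) * (2 : ℝ) ^ (∑ j ∈ Finset.Icc 1 i, r j)
    + (1 / (h n) ^ 2) * (2 : ℝ) ^ (∑ j ∈ Finset.Icc 1 n, r j)
    - 1 / (h 1) ^ 2

section powerCost

variable {h : ℕ → ℝ} {n : ℕ} {r r' : ℕ → ℝ}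

lemma powerCost_sum_le (hpos : ∀ i ∈ Finset.Icc 1 n, 0 < h i)
    (hmono : ∀ i ∈ Finset.Icc 1 (n - 1), h i ≤ h (i + 1))
    (hr : ∀ i ∈ Finset.Icc 1 n, r i ≤ r' i) :
    ∑ i ∈ Finset.Icc 1 (n - 1),
        (1 / (h i) ^ 2 - 1 / (h (i + 1)) ^ 2) * (2 : ℝ) ^ (∑ j ∈ Finset.Icc 1 i, r j) ≤
      ∑ i ∈ Finset.Icc 1 (n - 1),
        (1 / (h i) ^ 2 - 1 / (h (i + 1)) ^ 2) * (2 : ℝ) ^ (∑ j ∈ Finset.Icc 1 i, r' j) := by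
  refine Finset.sum_le_sum fun i hi => ?_
  have hle := hmono i hi
  rw [Finset.mem_Icc] at hi
  have hhi : 0 < h i := hpos i (Finset.mem_Icc.2 ⟨hi.1, by omega⟩)
  refine mul_le_mul_of_nonneg_left ?_ ?_
  · refine Real.rpow_le_rpow_of_exponent_le one_le_two (Finset.sum_le_sum fun j hj => hr j ?_)
    rw [Finset.mem_Icc] at hj ⊢
    omega
  · rw [sub_nonneg]
    gcongr

lemma powerCost_mono (hpos : ∀ i ∈ Finset.Icc 1 n, 0 < h i)
    (hmono : ∀ i ∈ Finset.Icc 1 (n - 1), h i ≤ h (i + 1))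
    (hr : ∀ i ∈ Finset.Icc 1 n, r i ≤ r' i) : powerCost h n r ≤ powerCost h n r' := by
  unfold powerCost
  have hlast : (2 : ℝ) ^ (∑ j ∈ Finset.Icc 1 n, r j) ≤ 2 ^ (∑ j ∈ Finset.Icc 1 n, r' j) :=
    Real.rpow_le_rpow_of_exponent_le one_le_two (Finset.sum_le_sum hr)
  gcongr ?_ + _ * ?_ - _
  exact powerCost_sum_le hpos hmono hr

lemma powerCost_lt (hpos : ∀ i ∈ Finset.Icc 1 n, 0 < h i)
    (hmono : ∀ i ∈ Finset.Icc 1 (n - 1), h i ≤ h (i + 1))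
    (hr : ∀ i ∈ Finset.Icc 1 n, r i ≤ r' i) (hlt : ∃ i ∈ Finset.Icc 1 n, r i < r' i) :
    powerCost h n r < powerCost h n r' := by
  have hn : 0 < h n := by
    obtain ⟨i, hi, -⟩ := hlt
    rw [Finset.mem_Icc] at hi
    exact hpos n (Finset.mem_Icc.2 ⟨hi.1.trans hi.2, le_rfl⟩)
  have hlast : (2 : ℝ) ^ (∑ j ∈ Finset.Icc 1 n, r j) < 2 ^ (∑ j ∈ Finset.Icc 1 n, r' j) :=
    Real.rpow_lt_rpow_of_exponent_lt one_lt_two (Finset.sum_lt_sum hr hlt)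
  have hmul := mul_lt_mul_of_pos_left hlast (show 0 < 1 / h n ^ 2 by positivity)
  have hsum := powerCost_sum_le hpos hmono hr
  unfold powerCost
  linarith

lemma continuousAt_powerCost_div (h : ℕ → ℝ) (n : ℕ) (c : ℕ → ℝ) {s : ℝ} (hs : s ≠ 0) :
    ContinuousAt (fun s => powerCost h n fun i => c i / s) s := by
  unfold powerCost
  fun_prop (disch := first | assumption | norm_num)

/-- Rates `c i / s` with slack in the power constraint stay feasible for some smaller `s`. -/
lemma exists_lt_powerCost_div_le (c : ℕ → ℝ) {s b : ℝ} (hs : 0 < s)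
    (hlt : powerCost h n (fun i => c i / s) < b) :
    ∃ s', 0 < s' ∧ s' < s ∧ powerCost h n (fun i => c i / s') ≤ b := by
  have hev := ((continuousAt_powerCost_div h n c hs.ne').eventually_lt_const hlt).and
    (lt_mem_nhds hs)
  obtain ⟨s', ⟨hb, hpos⟩, hs'⟩ :=
    ((hev.filter_mono nhdsWithin_le_nhds).and (self_mem_nhdsWithin (s := Set.Iio s))).exists
  exact ⟨s', hpos, hs', hb.le⟩

end powerCost

/-- Lemma 2 of the paper: in the convex reformulation of the centralized
concurrent-delivery minimization, any optimal pair `(r*, s*)` satisfies all the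
inequality constraints with equality. -/
theorem centralized_opt_at_boundary
    (K t : ℕ) (ht : 1 ≤ t) (htK : t < K) (h : ℕ → ℝ)
    (hpos : ∀ i ∈ Finset.Icc 1 (K - t), 0 < h i)
    (hmono : ∀ i ∈ Finset.Icc 1 (K - t - 1), h i ≤ h (i + 1))
    (rstar : ℕ → ℝ) (sstar : ℝ)
    -- feasibility of `(r*, s*)`
    (hrpos : ∀ i ∈ Finset.Icc 1 (K - t), 0 < rstar i)
    (hslack : ∀ i ∈ Finset.Icc 1 (K - t),
      ((K - i).choose t : ℝ) / ((K.choose t : ℝ) * rstar i) ≤ sstar)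
    (hcap : ∑ i ∈ Finset.Icc 1 (K - t - 1),
        (1 / (h i) ^ 2 - 1 / (h (i + 1)) ^ 2) *
          (2 : ℝ) ^ (∑ j ∈ Finset.Icc 1 i, rstar j)
      + (1 / (h (K - t)) ^ 2) *
          (2 : ℝ) ^ (∑ j ∈ Finset.Icc 1 (K - t), rstar j)
      - 1 / (h 1) ^ 2 ≤ 1)
    -- optimality of `(r*, s*)` among all feasible pairs `(r, s)`
    (hopt : ∀ (r : ℕ → ℝ) (s : ℝ),
      (∀ i ∈ Finset.Icc 1 (K - t), 0 < r i) →
      (∀ i ∈ Finset.Icc 1 (K - t),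
        ((K - i).choose t : ℝ) / ((K.choose t : ℝ) * r i) ≤ s) →
      (∑ i ∈ Finset.Icc 1 (K - t - 1),
          (1 / (h i) ^ 2 - 1 / (h (i + 1)) ^ 2) *
            (2 : ℝ) ^ (∑ j ∈ Finset.Icc 1 i, r j)
        + (1 / (h (K - t)) ^ 2) *
            (2 : ℝ) ^ (∑ j ∈ Finset.Icc 1 (K - t), r j)
        - 1 / (h 1) ^ 2 ≤ 1) →
      sstar ≤ s) :
    (∀ i ∈ Finset.Icc 1 (K - t),
      ((K - i).choose t : ℝ) / ((K.choose t : ℝ) * rstar i) = sstar) ∧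
    (∑ i ∈ Finset.Icc 1 (K - t - 1),
        (1 / (h i) ^ 2 - 1 / (h (i + 1)) ^ 2) *
          (2 : ℝ) ^ (∑ j ∈ Finset.Icc 1 i, rstar j)
      + (1 / (h (K - t)) ^ 2) *
          (2 : ℝ) ^ (∑ j ∈ Finset.Icc 1 (K - t), rstar j)
      - 1 / (h 1) ^ 2 = 1) := by
  set c : ℕ → ℝ := fun i => ((K - i).choose t : ℝ) / (K.choose t : ℝ) with hc
  have hcpos : ∀ i ∈ Finset.Icc 1 (K - t), 0 < c i := by
    intro i hi
    rw [Finset.mem_Icc] at hi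
    have hnum : 0 < (K - i).choose t := Nat.choose_pos (by omega)
    have hden : 0 < K.choose t := Nat.choose_pos htK.le
    simp only [hc]
    positivity
  simp only [← div_div] at hslack hopt ⊢
  have h1 : 1 ∈ Finset.Icc 1 (K - t) := Finset.mem_Icc.2 ⟨le_rfl, by omega⟩
  have hs : 0 < sstar := (div_pos (hcpos 1 h1) (hrpos 1 h1)).trans_le (hslack 1 h1)
  have hle : ∀ i ∈ Finset.Icc 1 (K - t), c i / sstar ≤ rstar i := fun i hi =>
    (div_le_comm₀ (hrpos i hi) hs).1 (hslack i hi)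
  have htight : ¬ powerCost h (K - t) (fun i => c i / sstar) < 1 := by
    intro hlt
    obtain ⟨s, hspos, hslt, hcost⟩ := exists_lt_powerCost_div_le c hs hlt
    refine hslt.not_ge (hopt (fun i => c i / s) s (fun i hi => div_pos (hcpos i hi) hspos)
      (fun i hi => ?_) hcost)
    exact (div_div_cancel₀ (hcpos i hi).ne').le
  refine ⟨fun i hi => ?_, hcap.antisymm ?_⟩
  · refine (hslack i hi).antisymm (le_of_not_gt fun hlt => htight ?_)
    exact (powerCost_lt hpos hmono hle
      ⟨i, hi, (div_lt_comm₀ (hrpos i hi) hs).1 hlt⟩).trans_le hcap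
  · exact (not_lt.1 htight).trans (powerCost_mono hpos hmono hle)
end

section
/- Let K, t be integers with 1 ≤ t < K and let 0 < h_1 ≤ h_2 ≤ ... ≤ h_{K−t} be real channel gains. Let s* be the unique positive root of g_c(s) = Σ_{i=1}^{K−t−1} (1/h_i^2 − 1/h_{i+1}^2)·2^{(C(K,t+1) − C(K−i,t+1))/(C(K,t)·s)} + (1/h_{K−t}^2)·2^{C(K,t+1)/(C(K,t)·s)} − 1/h_1^2 − 1, where C(n,k) denotes the binomial coefficient. Then the infimum of max_{1≤i≤K−t} C(K−i,t)/(C(K,t)·r_i), taken over all r ∈ ℝ^{K−t} with r_i > 0 for all i and Σ_{i=1}^{K−t−1} (1/h_i^2 − 1/h_{i+1}^2)·2^{r_1+...+r_i} + (1/h_{K−t}^2)·2^{r_1+...+r_{K−t}} − 1/h_1^2 ≤ 1, equals s*, and it is attained at the rate vector with r_i = C(K−i,t)/(C(K,t)·s*). -/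
open Finset Real

/-- Hockey-stick identity, summed from the top. -/
theorem sum_Icc_choose_sub (K t i : ℕ) (hi : i ≤ K) :
    ∑ j ∈ Finset.Icc 1 i, ((K - j).choose t : ℝ)
      = (K.choose (t + 1) : ℝ) - ((K - i).choose (t + 1) : ℝ) := by
  induction i with
  | zero => simp
  | succ n ih =>
    rw [Finset.sum_Icc_succ_top (by omega), ih (by omega)]
    have hsub : K - n = (K - (n + 1)) + 1 := by omega
    rw [hsub, Nat.choose_succ_succ]
    push_cast
    ring

/-- The power needed to support the rates `r` in the broadcast channel is strictly increasing
in the rates. -/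
theorem broadcast_power_lt_of_rates_lt (n : ℕ) (hn : 1 ≤ n) (h r r' : ℕ → ℝ)
    (hpos : ∀ i ∈ Finset.Icc 1 n, 0 < h i)
    (hmono : ∀ i ∈ Finset.Icc 1 (n - 1), h i ≤ h (i + 1))
    (hr : ∀ i ∈ Finset.Icc 1 n, r i < r' i) :
    ∑ i ∈ Finset.Icc 1 (n - 1), (1 / (h i) ^ 2 - 1 / (h (i + 1)) ^ 2) *
          (2 : ℝ) ^ (∑ j ∈ Finset.Icc 1 i, r j)
        + (1 / (h n) ^ 2) * (2 : ℝ) ^ (∑ j ∈ Finset.Icc 1 n, r j)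
      < ∑ i ∈ Finset.Icc 1 (n - 1), (1 / (h i) ^ 2 - 1 / (h (i + 1)) ^ 2) *
          (2 : ℝ) ^ (∑ j ∈ Finset.Icc 1 i, r' j)
        + (1 / (h n) ^ 2) * (2 : ℝ) ^ (∑ j ∈ Finset.Icc 1 n, r' j) := by
  apply add_lt_add_of_le_of_lt
  · refine Finset.sum_le_sum fun i hi => ?_
    have hi' := Finset.mem_Icc.mp hi
    have hhi : 0 < h i := hpos i (Finset.mem_Icc.mpr ⟨hi'.1, by omega⟩)
    have hcoef : 1 / (h (i + 1)) ^ 2 ≤ 1 / (h i) ^ 2 :=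
      one_div_le_one_div_of_le (by positivity) (pow_le_pow_left₀ hhi.le (hmono i hi) 2)
    refine mul_le_mul_of_nonneg_left ?_ (sub_nonneg.mpr hcoef)
    refine Real.rpow_le_rpow_of_exponent_le one_le_two (Finset.sum_le_sum fun j hj => ?_)
    have hj' := Finset.mem_Icc.mp hj
    exact (hr j (Finset.mem_Icc.mpr ⟨hj'.1, by omega⟩)).le
  · have hhn : 0 < h n := hpos n (Finset.mem_Icc.mpr ⟨hn, le_rfl⟩)
    refine mul_lt_mul_of_pos_left ?_ (by positivity)
    exact Real.rpow_lt_rpow_of_exponent_lt one_lt_two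
      (Finset.sum_lt_sum_of_nonempty (Finset.nonempty_Icc.mpr hn) hr)

/-- Theorem 2 combined with Lemma 2 of the paper: the minimal worst-group
transmission time of the centralized concurrent delivery scheme over the Gaussian
broadcast capacity region equals the unique positive root `s*` of `g_c`, and the
minimum is attained at the rate vector `r i = C(K-i,t)/(C(K,t)·s*)`. -/
theorem centralized_concurrent_time_eq_root
    (K t : ℕ) (ht : 1 ≤ t) (htK : t < K) (h : ℕ → ℝ)
    (hpos : ∀ i ∈ Finset.Icc 1 (K - t), 0 < h i)
    (hmono : ∀ i ∈ Finset.Icc 1 (K - t - 1), h i ≤ h (i + 1))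
    (sstar : ℝ) (hsstar : 0 < sstar)
    (hroot : ∑ i ∈ Finset.Icc 1 (K - t - 1),
        (1 / (h i) ^ 2 - 1 / (h (i + 1)) ^ 2) *
          (2 : ℝ) ^ (((K.choose (t + 1) : ℝ) - ((K - i).choose (t + 1) : ℝ)) /
            ((K.choose t : ℝ) * sstar))
      + (1 / (h (K - t)) ^ 2) *
          (2 : ℝ) ^ ((K.choose (t + 1) : ℝ) / ((K.choose t : ℝ) * sstar))
      - 1 / (h 1) ^ 2 - 1 = 0) :
    let feasible : (ℕ → ℝ) → Prop := fun r =>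
      (∀ i ∈ Finset.Icc 1 (K - t), 0 < r i) ∧
      (∑ i ∈ Finset.Icc 1 (K - t - 1),
          (1 / (h i) ^ 2 - 1 / (h (i + 1)) ^ 2) *
            (2 : ℝ) ^ (∑ j ∈ Finset.Icc 1 i, r j)
        + (1 / (h (K - t)) ^ 2) *
            (2 : ℝ) ^ (∑ j ∈ Finset.Icc 1 (K - t), r j)
        - 1 / (h 1) ^ 2 ≤ 1)
    let maxval : (ℕ → ℝ) → ℝ := fun r =>
      (Finset.Icc 1 (K - t)).sup' (Finset.nonempty_Icc.mpr (by omega))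
        (fun i => ((K - i).choose t : ℝ) / ((K.choose t : ℝ) * r i))
    let rstar : ℕ → ℝ := fun i => ((K - i).choose t : ℝ) / ((K.choose t : ℝ) * sstar)
    IsLeast {v : ℝ | ∃ r : ℕ → ℝ, feasible r ∧ v = maxval r} sstar ∧
    feasible rstar ∧ maxval rstar = sstar := by
  intro feasible maxval rstar
  have hKt : (0 : ℝ) < K.choose t := by exact_mod_cast Nat.choose_pos htK.le
  have hnum : ∀ i ∈ Finset.Icc 1 (K - t), (0 : ℝ) < ((K - i).choose t : ℝ) := by
    intro i hi
    have hi' := Finset.mem_Icc.mp hi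
    exact_mod_cast Nat.choose_pos (show t ≤ K - i by omega)
  have hsum : ∀ i ≤ K, ∑ j ∈ Finset.Icc 1 i, rstar j
      = ((K.choose (t + 1) : ℝ) - ((K - i).choose (t + 1) : ℝ)) / ((K.choose t : ℝ) * sstar) := by
    intro i hi
    rw [← sum_Icc_choose_sub K t i hi, Finset.sum_div]
  have hpower : ∑ i ∈ Finset.Icc 1 (K - t - 1), (1 / (h i) ^ 2 - 1 / (h (i + 1)) ^ 2) *
            (2 : ℝ) ^ (∑ j ∈ Finset.Icc 1 i, rstar j)
        + (1 / (h (K - t)) ^ 2) * (2 : ℝ) ^ (∑ j ∈ Finset.Icc 1 (K - t), rstar j)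
        - 1 / (h 1) ^ 2 = 1 := by
    rw [Finset.sum_congr rfl fun i hi => by
        rw [hsum i (by have := Finset.mem_Icc.mp hi; omega)],
      hsum (K - t) (Nat.sub_le K t), Nat.sub_sub_self htK.le,
      Nat.choose_eq_zero_of_lt (Nat.lt_succ_self t), Nat.cast_zero, sub_zero]
    linarith
  have hfeas : feasible rstar :=
    ⟨fun i hi => div_pos (hnum i hi) (mul_pos hKt hsstar), hpower.le⟩
  have hmax : maxval rstar = sstar := by
    have hval : ∀ i ∈ Finset.Icc 1 (K - t),
        ((K - i).choose t : ℝ) / ((K.choose t : ℝ) * rstar i) = sstar := by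
      intro i hi
      have := (hnum i hi).ne'
      simp only [rstar]
      field_simp
    exact (Finset.sup'_congr _ rfl hval).trans (Finset.sup'_const _ _)
  refine ⟨⟨⟨rstar, hfeas, hmax.symm⟩, ?_⟩, hfeas, hmax⟩
  rintro v ⟨r, ⟨hrpos, hrpower⟩, rfl⟩
  by_contra! hlt
  have hrates : ∀ i ∈ Finset.Icc 1 (K - t), rstar i < r i := by
    intro i hi
    have hle : ((K - i).choose t : ℝ) / ((K.choose t : ℝ) * r i) < sstar :=
      (Finset.sup'_lt_iff _).mp hlt i hi
    rw [div_lt_iff₀ (mul_pos hKt (hrpos i hi))] at hle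
    simp only [rstar]
    rw [div_lt_iff₀ (mul_pos hKt hsstar)]
    linarith
  have := broadcast_power_lt_of_rates_lt (K - t) (by omega) h rstar r hpos hmono hrates
  linarith
end

section
/- Let K be a positive integer, let q ∈ (0,1), and let 0 < h_1 ≤ h_2 ≤ ... ≤ h_K be real channel gains. Let s* be the unique positive root of g_d(s) = Σ_{i=1}^{K−1} (1/h_i^2 − 1/h_{i+1}^2)·2^{(1−q)(1−(1−q)^i)/(q·s)} + (1/h_K^2)·2^{(1−q)(1−(1−q)^K)/(q·s)} − 1/h_1^2 − 1. Then the infimum of max_{1≤i≤K} (1−q)^i/r_i, taken over all r ∈ ℝ^K with r_i > 0 for all i and Σ_{i=1}^{K−1} (1/h_i^2 − 1/h_{i+1}^2)·2^{r_1+...+r_i} + (1/h_K^2)·2^{r_1+...+r_K} − 1/h_1^2 ≤ 1, equals s*, and it is attained at the rate vector with r_i = (1−q)^i/s*. -/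
open Finset Real

/-- The geometric sum `x + x ^ 2 + ... + x ^ i` in terms of `q = 1 - x`, divided by `s`. -/
lemma sum_Icc_one_sub_pow_div {q s : ℝ} (hq : q ≠ 0) (hs : s ≠ 0) (i : ℕ) :
    ∑ j ∈ Finset.Icc 1 i, (1 - q) ^ j / s = (1 - q) * (1 - (1 - q) ^ i) / (q * s) := by
  induction i with
  | zero => simp
  | succ n ih =>
    rw [Finset.sum_Icc_succ_top (by omega), ih]
    field_simp
    ring

/-- The function defining the boundary of the broadcast capacity region is strictly increasing
in the rate vector. -/
lemma broadcast_sum_lt_of_lt {K : ℕ} (hK : 1 ≤ K) {h : ℕ → ℝ}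
    (hpos : ∀ i ∈ Finset.Icc 1 K, 0 < h i)
    (hmono : ∀ i ∈ Finset.Icc 1 (K - 1), h i ≤ h (i + 1))
    {r r' : ℕ → ℝ} (hr : ∀ i ∈ Finset.Icc 1 K, r i < r' i) :
    ∑ i ∈ Finset.Icc 1 (K - 1), (1 / (h i) ^ 2 - 1 / (h (i + 1)) ^ 2) *
        (2 : ℝ) ^ (∑ j ∈ Finset.Icc 1 i, r j)
      + (1 / (h K) ^ 2) * (2 : ℝ) ^ (∑ j ∈ Finset.Icc 1 K, r j) <
    ∑ i ∈ Finset.Icc 1 (K - 1), (1 / (h i) ^ 2 - 1 / (h (i + 1)) ^ 2) *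
        (2 : ℝ) ^ (∑ j ∈ Finset.Icc 1 i, r' j)
      + (1 / (h K) ^ 2) * (2 : ℝ) ^ (∑ j ∈ Finset.Icc 1 K, r' j) := by
  refine add_lt_add_of_le_of_lt (Finset.sum_le_sum fun i hi => ?_) ?_
  · have hi' := Finset.mem_Icc.mp hi
    have hi0 : 0 < h i := hpos i (Finset.mem_Icc.mpr ⟨hi'.1, by omega⟩)
    refine mul_le_mul_of_nonneg_left ?_ (sub_nonneg.mpr ?_)
    · refine Real.rpow_le_rpow_of_exponent_le one_le_two (Finset.sum_le_sum fun j hj => ?_)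
      have hj' := Finset.mem_Icc.mp hj
      exact (hr j (Finset.mem_Icc.mpr ⟨hj'.1, by omega⟩)).le
    · exact one_div_le_one_div_of_le (by positivity) (pow_le_pow_left₀ hi0.le (hmono i hi) 2)
  · have hK0 : 0 < h K := hpos K (Finset.mem_Icc.mpr ⟨hK, le_rfl⟩)
    refine mul_lt_mul_of_pos_left ?_ (by positivity)
    exact Real.rpow_lt_rpow_of_exponent_lt one_lt_two
      (Finset.sum_lt_sum_of_nonempty (Finset.nonempty_Icc.mpr hK) hr)

/-- Theorem 7 of the paper: the minimal worst-user transmission time of the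
decentralized concurrent delivery scheme over the Gaussian broadcast capacity region
equals the unique positive root `s*` of `g_d`, and the minimum is attained at the
rate vector `r i = (1-q)^i / s*`. -/
theorem decentralized_concurrent_time_eq_root
    (K : ℕ) (hK : 1 ≤ K) (q : ℝ) (hq : q ∈ Set.Ioo (0 : ℝ) 1) (h : ℕ → ℝ)
    (hpos : ∀ i ∈ Finset.Icc 1 K, 0 < h i)
    (hmono : ∀ i ∈ Finset.Icc 1 (K - 1), h i ≤ h (i + 1))
    (sstar : ℝ) (hsstar : 0 < sstar)
    (hroot : ∑ i ∈ Finset.Icc 1 (K - 1),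
        (1 / (h i) ^ 2 - 1 / (h (i + 1)) ^ 2) *
          (2 : ℝ) ^ ((1 - q) * (1 - (1 - q) ^ i) / (q * sstar))
      + (1 / (h K) ^ 2) * (2 : ℝ) ^ ((1 - q) * (1 - (1 - q) ^ K) / (q * sstar))
      - 1 / (h 1) ^ 2 - 1 = 0) :
    let feasible : (ℕ → ℝ) → Prop := fun r =>
      (∀ i ∈ Finset.Icc 1 K, 0 < r i) ∧
      (∑ i ∈ Finset.Icc 1 (K - 1),
          (1 / (h i) ^ 2 - 1 / (h (i + 1)) ^ 2) *
            (2 : ℝ) ^ (∑ j ∈ Finset.Icc 1 i, r j)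
        + (1 / (h K) ^ 2) * (2 : ℝ) ^ (∑ j ∈ Finset.Icc 1 K, r j)
        - 1 / (h 1) ^ 2 ≤ 1)
    let maxval : (ℕ → ℝ) → ℝ := fun r =>
      (Finset.Icc 1 K).sup' (Finset.nonempty_Icc.mpr (by omega))
        (fun i => (1 - q) ^ i / r i)
    let rstar : ℕ → ℝ := fun i => (1 - q) ^ i / sstar
    IsLeast {v : ℝ | ∃ r : ℕ → ℝ, feasible r ∧ v = maxval r} sstar ∧
    feasible rstar ∧ maxval rstar = sstar := by
  intro feasible maxval rstar
  have hq1 : 0 < 1 - q := sub_pos.mpr hq.2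
  simp only [← sum_Icc_one_sub_pow_div hq.1.ne' hsstar.ne'] at hroot
  have hfeas : feasible rstar :=
    ⟨fun i _ => div_pos (pow_pos hq1 i) hsstar, by linarith [hroot]⟩
  have hmax : maxval rstar = sstar := by
    have hconst : ∀ i, (1 - q) ^ i / rstar i = sstar := fun i =>
      div_div_cancel₀ (pow_pos hq1 i).ne'
    simp only [maxval, hconst, Finset.sup'_const]
  refine ⟨⟨⟨rstar, hfeas, hmax.symm⟩, ?_⟩, hfeas, hmax⟩
  rintro v ⟨r, ⟨hr, hcap⟩, rfl⟩
  by_contra! hlt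
  have hlt' : ∀ i ∈ Finset.Icc 1 K, rstar i < r i := fun i hi =>
    (div_lt_comm₀ (hr i hi) hsstar).mp ((Finset.sup'_lt_iff _).mp hlt i hi)
  linarith [broadcast_sum_lt_of_lt hK hpos hmono hlt']
end

section
/- Let K, t be integers with 1 ≤ t < K, set q = t/K, and let 0 < h_1 ≤ h_2 ≤ ... ≤ h_K be real channel gains. Then Σ_{i=1}^{K} (1−q)^i / log₂(1+h_i^2) ≤ (3/2) · (1/C(K,t)) · Σ_{i=1}^{K−t} C(K−i,t)/log₂(1+h_i^2), where C(n,k) denotes the binomial coefficient. In other words, T_{d,o}/T_{c,o} ≤ 1.5. -/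
open Finset Real

/-- If a finite sequence with nonnegative sum never recovers once it is negative, then
weighting it by nonincreasing nonnegative weights keeps its sum nonnegative. -/
theorem sum_mul_nonneg_of_neg_persists {K : ℕ} {c w : ℕ → ℝ}
    (hsum : 0 ≤ ∑ i ∈ Icc 1 K, c i)
    (hneg : ∀ i ∈ Icc 1 (K - 1), c i < 0 → c (i + 1) < 0)
    (hw : ∀ i ∈ Icc 1 K, 0 ≤ w i) (hanti : AntitoneOn w (Set.Icc 1 K)) :
    0 ≤ ∑ i ∈ Icc 1 K, c i * w i := by
  rcases Nat.eq_zero_or_pos K with rfl | hK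
  · simp
  obtain ⟨j, hj, hcj⟩ : ∃ j ∈ Icc 1 K, 0 ≤ c j := by
    by_contra! hall
    exact (sum_neg hall ⟨1, by simp; omega⟩).not_ge hsum
  obtain ⟨p, hp, hmax⟩ := ({i ∈ Icc 1 K | 0 ≤ c i}).exists_max_image id ⟨j, by simp_all⟩
  simp only [mem_filter, mem_Icc, id] at hp hmax
  have hpersist : ∀ i, 1 ≤ i → c i < 0 → ∀ k, i ≤ k → k ≤ K → c k < 0 := by
    intro i hi hci k hik
    induction k, hik using Nat.le_induction with
    | base => exact fun _ => hci
    | succ k hik ih => exact fun hk => hneg k (by simp; omega) (ih (by omega))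
  calc 0 ≤ (∑ i ∈ Icc 1 K, c i) * w p := mul_nonneg hsum (hw p (by simp [hp.1]))
    _ = ∑ i ∈ Icc 1 K, c i * w p := sum_mul ..
    _ ≤ ∑ i ∈ Icc 1 K, c i * w i := by
        refine sum_le_sum fun i hi => ?_
        rw [mem_Icc] at hi
        rcases le_total i p with hip | hpi
        · refine mul_le_mul_of_nonneg_left (hanti hi hp.1 hip) ?_
          by_contra! hci
          exact (hpersist i hi.1 hci p hip hp.1.2).not_ge hp.2
        · rcases hpi.eq_or_lt with rfl | hpi
          · rfl
          · refine mul_le_mul_of_nonpos_left (hanti hp.1 hi hpi.le) ?_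
            by_contra! hci
            exact (hmax i ⟨hi, hci.le⟩).not_gt hpi

theorem sum_Icc_choose_sub_add (K t : ℕ) {m : ℕ} (hm : m ≤ K) :
    ∑ i ∈ Icc 1 m, (K - i).choose t + (K - m).choose (t + 1) = K.choose (t + 1) := by
  induction m with
  | zero => simp
  | succ m ih =>
    rw [sum_Icc_succ_top (by omega), ← ih (by omega)]
    obtain ⟨n, rfl⟩ := Nat.exists_eq_add_of_le' hm
    rw [show n + (m + 1) - m = n + 1 by omega, Nat.add_sub_cancel, Nat.choose_succ_succ]
    ring

theorem sum_Icc_one_pow_mul_one_sub (x : ℝ) (m : ℕ) :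
    (∑ i ∈ Icc 1 m, x ^ i) * (1 - x) = x * (1 - x ^ m) := by
  induction m with
  | zero => simp
  | succ m ih => rw [sum_Icc_succ_top (by omega), add_mul, ih]; ring

theorem choose_le_choose_succ_mul_one_sub_div {n K : ℕ} (t : ℕ) (hn : n < K) :
    (n.choose t : ℝ) ≤ (n + 1).choose t * (1 - (t : ℝ) / K) := by
  rcases lt_or_ge (n + 1) t with hlt | hge
  · simp [Nat.choose_eq_zero_of_lt hlt, Nat.choose_eq_zero_of_lt (Nat.lt_of_succ_lt hlt)]
  · have hrec : (n.choose t : ℝ) * (n + 1) = (n + 1).choose t * (n + 1 - t) := by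
      have := congrArg (Nat.cast (R := ℝ)) (Nat.choose_mul_succ_eq n t)
      push_cast [Nat.cast_sub hge] at this
      exact this
    have hn0 : (0 : ℝ) < n + 1 := by positivity
    have hnK : (n : ℝ) + 1 ≤ K := by exact_mod_cast hn
    calc (n.choose t : ℝ) = (n + 1).choose t * (1 - (t : ℝ) / (n + 1)) := by
          field_simp
          linarith
      _ ≤ _ := by gcongr

theorem one_fourth_le_one_sub_inv_pow {K : ℕ} (hK : 2 ≤ K) :
    (1 / 4 : ℝ) ≤ (1 - 1 / (K : ℝ)) ^ K := by
  have hK' : (2 : ℝ) ≤ K := by exact_mod_cast hK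
  have hinv : 1 / (K : ℝ) ≤ 1 := by rw [div_le_one (by linarith)]; linarith
  have hbern := one_add_mul_self_le_rpow_one_add (s := -(1 / (K : ℝ))) (by linarith)
    (p := (K : ℝ) / 2) (by linarith)
  have hhalf : 1 + (K : ℝ) / 2 * -(1 / (K : ℝ)) = 1 / 2 := by field_simp; norm_num
  rw [hhalf, ← sub_eq_add_neg] at hbern
  calc (1 / 4 : ℝ) = (1 / 2) ^ 2 := by norm_num
    _ ≤ ((1 - 1 / (K : ℝ)) ^ ((K : ℝ) / 2)) ^ 2 := by gcongr
    _ = (1 - 1 / (K : ℝ)) ^ K := by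
        rw [← rpow_mul_natCast (by linarith), ← rpow_natCast]
        congr 1
        push_cast
        ring

theorem sum_one_sub_div_pow_le {K t : ℕ} (ht : 1 ≤ t) (htK : t < K) :
    ∑ i ∈ Icc 1 K, (1 - (t : ℝ) / K) ^ i ≤
      3 / 2 * ((∑ i ∈ Icc 1 K, ((K - i).choose t : ℝ)) / K.choose t) := by
  have ht' : (1 : ℝ) ≤ t := by exact_mod_cast ht
  have htK' : (t : ℝ) < K := by exact_mod_cast htK
  have hC : (0 : ℝ) < K.choose t := by exact_mod_cast Nat.choose_pos htK.le
  have hchoose : ∑ i ∈ Icc 1 K, ((K - i).choose t : ℝ) = K.choose (t + 1) := by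
    have := sum_Icc_choose_sub_add K t le_rfl
    rw [Nat.sub_self, Nat.choose_zero_succ, add_zero] at this
    exact_mod_cast this
  have hratio : (K.choose (t + 1) : ℝ) / K.choose t = (K - t) / (t + 1) := by
    have := congrArg (Nat.cast (R := ℝ)) (Nat.choose_succ_right_eq K t)
    push_cast [Nat.cast_sub htK.le] at this
    rw [div_eq_div_iff hC.ne' (by positivity), this, mul_comm]
  have hgeom : ∑ i ∈ Icc 1 K, (1 - (t : ℝ) / K) ^ i =
      (K - t) * (1 - (1 - (t : ℝ) / K) ^ K) / t := by
    have hK0 : (K : ℝ) ≠ 0 := by linarith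
    have := sum_Icc_one_pow_mul_one_sub (1 - (t : ℝ) / K) K
    rw [sub_sub_cancel] at this
    rw [eq_div_iff (by linarith)]
    calc _ = (∑ i ∈ Icc 1 K, (1 - (t : ℝ) / K) ^ i) * (t / K) * K := by field_simp
      _ = _ := by rw [this]; field_simp
  have hkey : (t + 1) * (1 - (1 - (t : ℝ) / K) ^ K) ≤ 3 / 2 * t := by
    rcases ht.eq_or_lt with rfl | ht2
    · have := one_fourth_le_one_sub_inv_pow (K := K) (by omega)
      push_cast
      linarith
    · have ht2' : (2 : ℝ) ≤ t := by exact_mod_cast ht2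
      have hx : 0 ≤ (1 - (t : ℝ) / K) ^ K :=
        pow_nonneg (sub_nonneg.2 (div_le_one_of_le₀ htK'.le (by linarith))) K
      nlinarith
  rw [hchoose, hratio, hgeom, ← mul_div_assoc, div_le_div_iff₀ (by linarith) (by linarith)]
  linarith [mul_le_mul_of_nonneg_left hkey (sub_nonneg.2 htK'.le)]

/-- Theorem 3 of the paper: with the same orthogonal delivery scheme, the
transmission time of the decentralized placement is at most `1.5` times that of the
centralized placement: `T_{d,o} ≤ (3/2) · T_{c,o}` (here `q = t/K`). -/
theorem orthogonal_gap_le_three_halves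
    (K t : ℕ) (ht : 1 ≤ t) (htK : t < K) (h : ℕ → ℝ)
    (hpos : ∀ i ∈ Finset.Icc 1 K, 0 < h i)
    (hmono : ∀ i ∈ Finset.Icc 1 (K - 1), h i ≤ h (i + 1)) :
    ∑ i ∈ Finset.Icc 1 K,
        (1 - (t : ℝ) / (K : ℝ)) ^ i / Real.logb 2 (1 + (h i) ^ 2)
      ≤ (3 / 2) * ((1 / (K.choose t : ℝ)) *
        ∑ i ∈ Finset.Icc 1 (K - t),
          ((K - i).choose t : ℝ) / Real.logb 2 (1 + (h i) ^ 2)) := by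
  have htK' : (t : ℝ) < K := by exact_mod_cast htK
  have hC : (0 : ℝ) < K.choose t := by exact_mod_cast Nat.choose_pos htK.le
  have hx : 0 < 1 - (t : ℝ) / K :=
    sub_pos.2 ((div_lt_one (lt_of_le_of_lt (Nat.cast_nonneg t) htK')).2 htK')
  have hlog : ∀ i ∈ Icc 1 K, 0 < logb 2 (1 + h i ^ 2) := fun i hi =>
    logb_pos one_lt_two (lt_add_of_pos_right 1 (pow_pos (hpos i hi) 2))
  have hhmono : MonotoneOn h (Set.Icc 1 K) := by
    intro i hi j hj hij
    induction j, hij using Nat.le_induction with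
    | base => rfl
    | succ j hij ih =>
      exact (ih ⟨hi.1.trans hij, (Nat.le_succ j).trans hj.2⟩).trans
        (hmono j (mem_Icc.2 ⟨hi.1.trans hij, Nat.le_sub_one_of_lt hj.2⟩))
  have hanti : AntitoneOn (fun i => (logb 2 (1 + h i ^ 2))⁻¹) (Set.Icc 1 K) := by
    intro i hi j hj hij
    have hi0 := hpos i (mem_Icc.2 hi)
    have hle := hhmono hi hj hij
    exact inv_anti₀ (hlog i (mem_Icc.2 hi))
      (logb_le_logb_of_le one_lt_two (by positivity) (by gcongr))
  have hext : ∑ i ∈ Icc 1 (K - t), ((K - i).choose t : ℝ) / logb 2 (1 + h i ^ 2) =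
      ∑ i ∈ Icc 1 K, ((K - i).choose t : ℝ) / logb 2 (1 + h i ^ 2) := by
    refine sum_subset (Icc_subset_Icc_right (Nat.sub_le K t)) fun i hi hi' => ?_
    rw [mem_Icc] at hi hi'
    rw [Nat.choose_eq_zero_of_lt (by omega), Nat.cast_zero, zero_div]
  have hmain := sum_mul_nonneg_of_neg_persists
    (c := fun i => 3 / 2 * (((K - i).choose t : ℝ) / K.choose t) - (1 - (t : ℝ) / K) ^ i)
    (w := fun i => (logb 2 (1 + h i ^ 2))⁻¹) (K := K) ?_ ?_
    (fun i hi => (inv_pos.2 (hlog i hi)).le) hanti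
  · rw [hext, ← sub_nonneg, mul_sum, mul_sum, ← sum_sub_distrib]
    convert hmain using 2 with i
    ring
  · rw [sum_sub_distrib, ← mul_sum, ← sum_div]
    exact sub_nonneg.2 (sum_one_sub_div_pow_le ht htK)
  · intro i hi hci
    rw [mem_Icc] at hi
    have hstep := choose_le_choose_succ_mul_one_sub_div (n := K - (i + 1)) (K := K) t (by omega)
    rw [show K - (i + 1) + 1 = K - i by omega] at hstep
    have hdiv := div_le_div_of_nonneg_right hstep hC.le
    have hmul := mul_neg_of_neg_of_pos hci hx
    rw [mul_div_right_comm] at hdiv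
    rw [sub_mul, ← pow_succ] at hmul
    linarith
end

section
/- Let K, t be integers with 1 ≤ t < K and set l = K − t. Let m > 0 and let 0 = δ_1 ≤ δ_2 ≤ ... ≤ δ_l be reals. Define a_i = C(K−i,t)/C(K,t) for 1 ≤ i ≤ l and b_j = ((K−t)/K)^j for 1 ≤ j ≤ K, where C(n,k) denotes the binomial coefficient. Then (Σ_{i=1}^{l} a_i) · ( Σ_{i=1}^{l−1} b_i/(m+δ_i) + (Σ_{j=l}^{K} b_j)/(m+δ_l) ) ≤ (Σ_{j=1}^{K} b_j) · ( Σ_{i=1}^{l} a_i/(m+δ_i) ). -/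
open Finset Real

/-- A Chebyshev-type sum inequality: if `a / b` (in cross-multiplied form) and `w` are both
decreasing on `s`, the `a`-weighted mean of `w` is at least its `b`-weighted mean. -/
theorem sum_mul_sum_le_of_cross_antitone {ι : Type*} [LinearOrder ι] (s : Finset ι)
    (a b w : ι → ℝ)
    (hab : ∀ i ∈ s, ∀ j ∈ s, i ≤ j → a j * b i ≤ a i * b j) (hw : AntitoneOn w s) :
    (∑ i ∈ s, a i) * (∑ i ∈ s, b i * w i) ≤ (∑ i ∈ s, b i) * (∑ i ∈ s, a i * w i) := by
  have key : 0 ≤ ∑ i ∈ s, ∑ j ∈ s, (a i * b j - a j * b i) * (w i - w j) := by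
    refine sum_nonneg fun i hi => sum_nonneg fun j hj => ?_
    rcases le_total i j with h | h
    · exact mul_nonneg (sub_nonneg.2 (hab i hi j hj h)) (sub_nonneg.2 (hw hi hj h))
    · exact mul_nonneg_of_nonpos_of_nonpos (sub_nonpos.2 (hab j hj i hi h))
        (sub_nonpos.2 (hw hj hi h))
  have expand : ∑ i ∈ s, ∑ j ∈ s, (a i * b j - a j * b i) * (w i - w j) =
      2 * ((∑ i ∈ s, b i) * (∑ i ∈ s, a i * w i) -
        (∑ i ∈ s, a i) * (∑ i ∈ s, b i * w i)) := by
    have h : ∀ i j, (a i * b j - a j * b i) * (w i - w j) =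
        (a i * w i) * b j - a i * (b j * w j) - (b i * w i) * a j + b i * (a j * w j) :=
      fun i j => by ring
    simp only [h, sum_add_distrib, sum_sub_distrib, ← mul_sum, ← sum_mul]
    ring
  linarith

theorem choose_mul_le_succ_choose_mul {n K : ℕ} (t : ℕ) (hn : n + 1 ≤ K) :
    n.choose t * K ≤ (n + 1).choose t * (K - t) := by
  rcases lt_or_ge n t with h | h
  · simp [Nat.choose_eq_zero_of_lt h]
  · have e := Nat.choose_mul_succ_eq n t
    refine Nat.le_of_mul_le_mul_right (c := n + 1) ?_ n.succ_pos
    calc n.choose t * K * (n + 1) = (n + 1).choose t * ((n + 1 - t) * K) := by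
          rw [mul_right_comm, e, mul_assoc]
      _ ≤ (n + 1).choose t * ((K - t) * (n + 1)) := by
          refine Nat.mul_le_mul_left _ ?_
          rw [Nat.sub_mul, Nat.sub_mul, mul_comm (n + 1) K]
          exact Nat.sub_le_sub_left (Nat.mul_le_mul_left t hn) _
      _ = (n + 1).choose t * (K - t) * (n + 1) := (mul_assoc _ _ _).symm

theorem choose_sub_le_mul_pow {K t : ℕ} (hK : 0 < K) (ht : 1 ≤ t) (i d : ℕ) :
    ((K - (i + d)).choose t : ℝ) ≤
      ((K - i).choose t : ℝ) * (((K - t : ℕ) : ℝ) / (K : ℝ)) ^ d := by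
  induction d with
  | zero => simp
  | succ d ih =>
    have hK' : (0 : ℝ) < K := by exact_mod_cast hK
    have step : ((K - (i + (d + 1))).choose t : ℝ) ≤
        ((K - (i + d)).choose t : ℝ) * (((K - t : ℕ) : ℝ) / (K : ℝ)) := by
      rw [← mul_div_assoc, le_div_iff₀ hK']
      rcases lt_or_ge (i + d) K with h | h
      · have := choose_mul_le_succ_choose_mul (n := K - (i + (d + 1))) (K := K) t (by omega)
        rw [show K - (i + (d + 1)) + 1 = K - (i + d) by omega] at this
        exact_mod_cast this
      · rw [Nat.choose_eq_zero_of_lt (show K - (i + (d + 1)) < t by omega)]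
        simp only [Nat.cast_zero, zero_mul]
        positivity
    calc _ ≤ _ := step
      _ ≤ _ := mul_le_mul_of_nonneg_right ih (by positivity)
      _ = _ := by rw [pow_succ, mul_assoc]

/-- The inequality `f₁ ≤ f₂` of Appendix E of the paper: with `l = K - t`,
`a i = C(K-i,t)/C(K,t)`, `b j = ((K-t)/K)^j`, `m > 0` and
`0 = δ 1 ≤ δ 2 ≤ ⋯ ≤ δ l`, one has
`(Σ_{i=1}^{l} a i)·(Σ_{i=1}^{l-1} b i/(m+δ i) + (Σ_{j=l}^{K} b j)/(m+δ l))
  ≤ (Σ_{j=1}^{K} b j)·(Σ_{i=1}^{l} a i/(m+δ i))`. -/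
theorem f1_le_f2
    (K t : ℕ) (ht : 1 ≤ t) (htK : t < K)
    (m : ℝ) (hm : 0 < m) (δ : ℕ → ℝ) (hδ1 : δ 1 = 0)
    (hδmono : ∀ i ∈ Finset.Icc 1 (K - t - 1), δ i ≤ δ (i + 1)) :
    let l : ℕ := K - t
    let a : ℕ → ℝ := fun i => ((K - i).choose t : ℝ) / (K.choose t : ℝ)
    let b : ℕ → ℝ := fun j => (((K - t : ℕ) : ℝ) / (K : ℝ)) ^ j
    (∑ i ∈ Finset.Icc 1 l, a i) *
        ((∑ i ∈ Finset.Icc 1 (l - 1), b i / (m + δ i)) +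
          (∑ j ∈ Finset.Icc l K, b j) / (m + δ l))
      ≤ (∑ j ∈ Finset.Icc 1 K, b j) * (∑ i ∈ Finset.Icc 1 l, a i / (m + δ i)) := by
  intro l a b
  have hl : 1 ≤ l := by simp only [l]; omega
  have hlK : l ≤ K := Nat.sub_le K t
  have hδ : MonotoneOn δ (Set.Icc 1 l) := by
    refine monotoneOn_of_le_add_one Set.ordConnected_Icc fun i _ hi hi' => ?_
    rw [Set.mem_Icc] at hi hi'
    exact hδmono i (mem_Icc.2 ⟨hi.1, by simp only [l] at hi'; omega⟩)
  set w : ℕ → ℝ := fun i => (m + δ (min i l))⁻¹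
  have hw : AntitoneOn w (Icc 1 K : Finset ℕ) := by
    intro i hi j hj hij
    simp only [coe_Icc, Set.mem_Icc] at hi hj
    have h0 : 0 ≤ δ (min i l) :=
      hδ1 ▸ hδ ⟨le_rfl, hl⟩ ⟨le_min hi.1 hl, min_le_right _ _⟩ (le_min hi.1 hl)
    have h1 : δ (min i l) ≤ δ (min j l) :=
      hδ ⟨le_min hi.1 hl, min_le_right _ _⟩ ⟨le_min hj.1 hl, min_le_right _ _⟩
        (min_le_min_right l hij)
    exact inv_anti₀ (by linarith) (by linarith)
  have hab : ∀ i ∈ Icc 1 K, ∀ j ∈ Icc 1 K, i ≤ j → a j * b i ≤ a i * b j := by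
    intro i _ j _ hij
    obtain ⟨d, rfl⟩ := Nat.exists_eq_add_of_le hij
    have h := choose_sub_le_mul_pow (by omega : 0 < K) ht i d
    simp only [a, b]
    rw [div_mul_eq_mul_div, div_mul_eq_mul_div, pow_add, mul_left_comm, mul_comm]
    gcongr
  have ha : ∀ i ∈ Icc 1 K, i ∉ Icc 1 l → a i = 0 := by
    intro i hi hi'
    rw [mem_Icc] at hi hi'
    have : K - i < t := by simp only [l] at hi'; omega
    simp [a, Nat.choose_eq_zero_of_lt this]
  have hsub : Icc 1 l ⊆ Icc 1 K := Icc_subset_Icc_right hlK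
  have hA : ∑ i ∈ Icc 1 l, a i = ∑ i ∈ Icc 1 K, a i := sum_subset hsub ha
  have hAw : ∑ i ∈ Icc 1 l, a i / (m + δ i) = ∑ i ∈ Icc 1 K, a i * w i := by
    rw [← sum_subset hsub fun i hi hi' => by rw [ha i hi hi', zero_mul]]
    refine sum_congr rfl fun i hi => ?_
    simp only [w, div_eq_mul_inv, min_eq_left (mem_Icc.1 hi).2]
  have hBw : (∑ i ∈ Icc 1 (l - 1), b i / (m + δ i)) + (∑ j ∈ Icc l K, b j) / (m + δ l) =
      ∑ i ∈ Icc 1 K, b i * w i := by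
    have hunion : Icc 1 K = Icc 1 (l - 1) ∪ Icc l K := by
      ext i
      simp only [mem_union, mem_Icc]
      omega
    have hdisj : Disjoint (Icc 1 (l - 1)) (Icc l K) := by
      rw [Finset.disjoint_left]
      intro i
      simp only [mem_Icc]
      omega
    rw [hunion, sum_union hdisj, sum_div]
    congr 1
    · refine sum_congr rfl fun i hi => ?_
      simp only [w, div_eq_mul_inv, min_eq_left ((mem_Icc.1 hi).2.trans (Nat.sub_le l 1))]
    · refine sum_congr rfl fun i hi => ?_
      simp only [w, div_eq_mul_inv, min_eq_right (mem_Icc.1 hi).1]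
  rw [hA, hAw, hBw]
  exact sum_mul_sum_le_of_cross_antitone _ a b w hab hw
end

section
/- Let K, t be integers with 1 ≤ t < K. Then for all integers i, j with 1 ≤ i < j ≤ K − t: C(K−j,t) · ((K−t)/K)^i < C(K−i,t) · ((K−t)/K)^j, where C(n,k) denotes the binomial coefficient. Equivalently, with a_i = C(K−i,t)/C(K,t) and b_i = ((K−t)/K)^i, one has a_j/a_i < b_j/b_i, i.e., a_j·b_i < a_i·b_j. -/
open Finset Real

theorem choose_lt_choose_succ_mul_div {K t n : ℕ} (ht : 1 ≤ t) (htn : t ≤ n + 1)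
    (hn : n + 1 < K) :
    (n.choose t : ℝ) < ((n + 1).choose t : ℝ) * (((K - t : ℕ) : ℝ) / (K : ℝ)) := by
  have hpos : (0 : ℝ) < ((n + 1).choose t : ℝ) := by exact_mod_cast Nat.choose_pos htn
  have hrec : (n.choose t : ℝ) * (n + 1) = ((n + 1).choose t : ℝ) * (n + 1 - t) := by
    have h := congrArg (Nat.cast (R := ℝ)) (Nat.choose_mul_succ_eq n t)
    push_cast [Nat.cast_sub htn] at h
    exact h
  have htR : (0 : ℝ) < t := by exact_mod_cast ht
  have hnR : (n : ℝ) + 1 < K := by exact_mod_cast hn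
  have hn0 : (0 : ℝ) < (n : ℝ) + 1 := by positivity
  have hK0 : (0 : ℝ) < K := hn0.trans hnR
  rw [Nat.cast_sub (htn.trans hn.le), eq_div_of_mul_eq hn0.ne' hrec, mul_div_assoc]
  refine mul_lt_mul_of_pos_left ?_ hpos
  rw [div_lt_div_iff₀ hn0 hK0]
  nlinarith [mul_lt_mul_of_pos_left hnR htR]

/-- The cross-term comparison of Appendix E of the paper: for `1 ≤ i < j ≤ K - t`,
`C(K-j,t)·((K-t)/K)^i < C(K-i,t)·((K-t)/K)^j`, i.e. with `a i = C(K-i,t)/C(K,t)` and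
`b i = ((K-t)/K)^i` one has `a j · b i < a i · b j`. -/
theorem cross_term_comparison
    (K t : ℕ) (ht : 1 ≤ t) (htK : t < K) :
    ∀ i j : ℕ, 1 ≤ i → i < j → j ≤ K - t →
      ((K - j).choose t : ℝ) * ((((K - t : ℕ) : ℝ)) / (K : ℝ)) ^ i <
        ((K - i).choose t : ℝ) * ((((K - t : ℕ) : ℝ)) / (K : ℝ)) ^ j := by
  intro i j hi hij hj
  have hq : (0 : ℝ) < ((K - t : ℕ) : ℝ) / (K : ℝ) := by
    have h1 : 0 < K - t := by omega
    have h2 : 0 < K := by omega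
    positivity
  have step : ∀ m, 1 ≤ m → m + 1 ≤ K - t → ((K - (m + 1)).choose t : ℝ) <
      ((K - m).choose t : ℝ) * (((K - t : ℕ) : ℝ) / (K : ℝ)) := by
    intro m hm hmt
    have h := choose_lt_choose_succ_mul_div (K := K) (n := K - (m + 1)) ht
      (by omega) (by omega)
    rwa [show K - (m + 1) + 1 = K - m by omega] at h
  induction j, hij using Nat.le_induction with
  | base =>
    rw [pow_succ', ← mul_assoc]
    exact mul_lt_mul_of_pos_right (step i hi hj) (pow_pos hq i)
  | succ j hij ih =>
    have hstep := mul_lt_mul_of_pos_right (step j (by omega) hj) (pow_pos hq i)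
    have hih := mul_lt_mul_of_pos_right (ih (by omega)) hq
    calc _ < _ := hstep
      _ = _ := mul_right_comm _ _ _
      _ < _ := hih
      _ = _ := by rw [pow_succ, mul_assoc]
end
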